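/- Let h⁰, h ∈ H and let Σ_Λ = {Σ_λ = (γ_λ,f_λ,g_λ)}_{λ∈Λ} satisfy Assumption 1 with α_λ(t,r) = r for all t,r ≥ 0 and all λ ∈ Λ. Suppose that the family of differential equations ẇ = −φ_λ(t,w), λ ∈ Λ, is GUAS. Then Σ_Λ is weakly (h⁰,h)-ISS. If, in addition, Γ_Λ = {γ_λ : λ ∈ Λ} is uniformly incrementally bounded (UIB), then Σ_Λ is strongly (h⁰,h)-ISS. -/

import Mathlib

open MeasureTheory Filter Set
open scoped Classical

noncomputable section

/-- State/input spaces: `ℝ^k` with the Euclidean norm. -/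
abbrev Stt (k : ℕ) : Type := EuclideanSpace ℝ (Fin k)

/-- An impulse-time sequence, identified with its (locally finite) set of impulse
times, a subset of `(0,∞)` with finitely many points below any bound. -/
def IsImpulseSeq (γ : Set ℝ) : Prop :=
  γ ⊆ Set.Ioi (0 : ℝ) ∧ ∀ T : ℝ, (γ ∩ Set.Iic T).Finite

/-- `n^γ_{(s,t]}`: the number of impulse times in the interval `(s,t]`. -/
def nJumps (γ : Set ℝ) (s t : ℝ) : ℕ := (γ ∩ Set.Ioc s t).ncard

/-- Uniform incremental boundedness of a set of impulse-time sequences. -/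
def UIB (S : Set (Set ℝ)) : Prop :=
  ∃ φ : ℝ → ℝ, ContinuousOn φ (Set.Ici 0) ∧ MonotoneOn φ (Set.Ici 0) ∧
    (∀ s : ℝ, 0 ≤ s → 0 ≤ φ s) ∧
    ∀ γ ∈ S, ∀ t0 t : ℝ, 0 ≤ t0 → t0 < t → (nJumps γ t0 t : ℝ) ≤ φ (t - t0)

/-- Class `K∞` functions `[0,∞) → [0,∞)`. -/
def ClassKInf (α : ℝ → ℝ) : Prop :=
  ContinuousOn α (Set.Ici 0) ∧ StrictMonoOn α (Set.Ici 0) ∧ α 0 = 0 ∧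
    ∀ M : ℝ, ∃ r : ℝ, 0 ≤ r ∧ M ≤ α r

/-- Class `KL` functions. -/
def ClassKL (β : ℝ → ℝ → ℝ) : Prop :=
  (∀ t : ℝ, 0 ≤ t → ClassKInf fun r => β r t) ∧
  ∀ r : ℝ, 0 ≤ r → AntitoneOn (fun t => β r t) (Set.Ici 0) ∧
    Filter.Tendsto (fun t => β r t) Filter.atTop (nhds 0)

/-- Positive definite functions `[0,∞) → [0,∞)`. -/
def PosDef (ρ : ℝ → ℝ) : Prop :=
  ContinuousOn ρ (Set.Ici 0) ∧ ρ 0 = 0 ∧ ∀ r : ℝ, 0 < r → 0 < ρ r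

/-- Locally integrable (on compacts) function `[0,∞) → ℝ` (extended to `ℝ`). -/
def LocIntegrable (p : ℝ → ℝ) : Prop :=
  ∀ a b : ℝ, MeasureTheory.IntegrableOn p (Set.Icc a b)

/-- Inputs: measurable, locally essentially bounded functions. -/
def IsInput {m : ℕ} (u : ℝ → Stt m) : Prop :=
  Measurable u ∧ ∀ T : ℝ, ∃ C : ℝ, ∀ᵐ t ∂MeasureTheory.volume, t ∈ Set.Icc 0 T → ‖u t‖ ≤ C

/-- `‖u_I‖_γ`: max of the essential supremum of `‖u‖` over `I` and the supremum of
`‖u‖` over `γ ∩ I`. -/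
def inputNorm {m : ℕ} (γ : Set ℝ) (u : ℝ → Stt m) (I : Set ℝ) : ℝ :=
  max (essSup (fun t => ‖u t‖) (MeasureTheory.volume.restrict I))
      (sSup ((fun t => ‖u t‖) '' (γ ∩ I)))

/-- Solution of the impulsive system `(γ,f,g)` on `[t0,T)` with initial state `x0`
and input `u` (Carathéodory solutions, in integral form, between impulses). -/
structure IsSolution {n m : ℕ} (γ : Set ℝ) (f g : ℝ → Stt n → Stt m → Stt n)
    (t0 : ℝ) (x0 : Stt n) (u : ℝ → Stt m) (T : EReal) (x : ℝ → Stt n) : Prop where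
  lt : (t0 : EReal) < T
  init : x t0 = x0
  flow : ∀ t1 t2 : ℝ, t0 ≤ t1 → t1 ≤ t2 → (t2 : EReal) < T → Set.Ioc t1 t2 ∩ γ = ∅ →
    MeasureTheory.IntegrableOn (fun s => f s (x s) (u s)) (Set.Icc t1 t2) ∧
    x t2 = x t1 + ∫ s in t1..t2, f s (x s) (u s)
  jump : ∀ t ∈ γ, t0 < t → (t : EReal) < T →
    ∃ L : Stt n, Filter.Tendsto x (nhdsWithin t (Set.Iio t)) (nhds L) ∧
      x t = L + g t L (u t)

/-- Maximally defined solution. -/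
def IsMaxSolution {n m : ℕ} (γ : Set ℝ) (f g : ℝ → Stt n → Stt m → Stt n)
    (t0 : ℝ) (x0 : Stt n) (u : ℝ → Stt m) (T : EReal) (x : ℝ → Stt n) : Prop :=
  IsSolution γ f g t0 x0 u T x ∧
    ∀ (T' : EReal) (x' : ℝ → Stt n), IsSolution γ f g t0 x0 u T' x' →
      (∀ t : ℝ, t0 ≤ t → (t : EReal) < T → x' t = x t) → T' ≤ T

/-- Weak `(h⁰,h)`-ISS of a parametrized family of impulsive systems. -/
def WeaklyISS {n m : ℕ} {Λ : Type*} (γ : Λ → Set ℝ)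
    (f g : Λ → ℝ → Stt n → Stt m → Stt n) (h0 h : ℝ → Stt n → ℝ) : Prop :=
  ∃ β : ℝ → ℝ → ℝ, ∃ ρ : ℝ → ℝ, ClassKL β ∧ ClassKInf ρ ∧
    ∀ (l : Λ) (t0 : ℝ) (x0 : Stt n) (u : ℝ → Stt m) (T : EReal) (x : ℝ → Stt n),
      0 ≤ t0 → IsInput u → IsMaxSolution (γ l) (f l) (g l) t0 x0 u T x →
      ∀ t : ℝ, t0 ≤ t → (t : EReal) < T →
        h t (x t) ≤ β (h0 t0 x0) (t - t0) + ρ (inputNorm (γ l) u (Set.Ioc t0 t))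

/-- Strong `(h⁰,h)`-ISS of a parametrized family of impulsive systems. -/
def StronglyISS {n m : ℕ} {Λ : Type*} (γ : Λ → Set ℝ)
    (f g : Λ → ℝ → Stt n → Stt m → Stt n) (h0 h : ℝ → Stt n → ℝ) : Prop :=
  ∃ β : ℝ → ℝ → ℝ, ∃ ρ : ℝ → ℝ, ClassKL β ∧ ClassKInf ρ ∧
    ∀ (l : Λ) (t0 : ℝ) (x0 : Stt n) (u : ℝ → Stt m) (T : EReal) (x : ℝ → Stt n),
      0 ≤ t0 → IsInput u → IsMaxSolution (γ l) (f l) (g l) t0 x0 u T x →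
      ∀ t : ℝ, t0 ≤ t → (t : EReal) < T →
        h t (x t) ≤ β (h0 t0 x0) (t - t0 + (nJumps (γ l) t0 t : ℝ)) +
          ρ (inputNorm (γ l) u (Set.Ioc t0 t))

/-- Locally Lipschitz on a set. -/
def LocLipschitzOn {α β : Type*} [PseudoEMetricSpace α] [PseudoEMetricSpace β]
    (s : Set α) (f : α → β) : Prop :=
  ∀ x ∈ s, ∃ K : NNReal, ∃ t ∈ nhdsWithin x s, LipschitzOnWith K f t

/-- `V ∈ V(γ)` with `Vm` its left-limit function at impulse times: `V` is locally
Lipschitz on each inter-impulse strip and has the joint left limit `Vm τ ξ`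
at each `τ ∈ γ`. -/
def InClassV {n : ℕ} (γ : Set ℝ) (V Vm : ℝ → Stt n → ℝ) : Prop :=
  (∀ a b : ℝ, 0 ≤ a → Set.Ioo a b ∩ γ = ∅ →
    LocLipschitzOn (Set.Ico a b ×ˢ (Set.univ : Set (Stt n)))
      (fun q : ℝ × Stt n => V q.1 q.2)) ∧
  ∀ τ ∈ γ, ∀ ξ : Stt n,
    Filter.Tendsto (fun q : ℝ × Stt n => V q.1 q.2)
      (nhdsWithin (τ, ξ) (Set.Iio τ ×ˢ (Set.univ : Set (Stt n)))) (nhds (Vm τ ξ))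

/-- Upper-right Dini derivative of `V` along the flow map `f`. -/
def DiniAlong {n m : ℕ} (f : ℝ → Stt n → Stt m → Stt n) (V : ℝ → Stt n → ℝ)
    (t : ℝ) (ξ : Stt n) (μ : Stt m) : ℝ :=
  Filter.limsup (fun d : ℝ => (V (t + d) (ξ + d • f t ξ μ) - V t ξ) / d)
    (nhdsWithin 0 (Set.Ioi 0))

/-- Carathéodory function `[0,∞) × [0,∞) → ℝ`. -/
def Caratheodory2 (φ : ℝ → ℝ → ℝ) : Prop :=
  (∀ r : ℝ, Measurable fun t => φ t r) ∧
  (∀ t : ℝ, ContinuousOn (φ t) (Set.Ici 0)) ∧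
  ∀ a b c : ℝ, ∃ mK : ℝ → ℝ, MeasureTheory.IntegrableOn mK (Set.Icc a b) ∧
    ∀ t ∈ Set.Icc a b, ∀ r ∈ Set.Icc (0 : ℝ) c, |φ t r| ≤ mK t

/-- Assumption 1 of the paper, with all the data explicit. -/
def Assumption1 {n m : ℕ} {Λ : Type*} (γ : Λ → Set ℝ)
    (f g : Λ → ℝ → Stt n → Stt m → Stt n) (h0 h : ℝ → Stt n → ℝ)
    (V Vm : Λ → ℝ → Stt n → ℝ) (φ1 φ2 χ π : ℝ → ℝ)
    (vφ al : Λ → ℝ → ℝ → ℝ) : Prop :=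
  ClassKInf φ1 ∧ ClassKInf φ2 ∧ ClassKInf χ ∧ ClassKInf π ∧
  (∀ l : Λ, InClassV (γ l) (V l) (Vm l)) ∧
  (∀ l : Λ, Caratheodory2 (vφ l)) ∧
  (∀ (l : Λ) (t r : ℝ), 0 ≤ t → 0 ≤ r → 0 ≤ al l t r) ∧
  (∀ (l : Λ) (t : ℝ) (ξ : Stt n), 0 ≤ t →
    φ1 (h t ξ) ≤ V l t ξ ∧ V l t ξ ≤ φ2 (h0 t ξ)) ∧
  (∀ (l : Λ) (t : ℝ) (ξ : Stt n) (μ : Stt m), 0 ≤ t → t ∉ γ l → χ ‖μ‖ ≤ V l t ξ →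
    DiniAlong (f l) (V l) t ξ μ ≤ - vφ l t (V l t ξ)) ∧
  (∀ (l : Λ) (t : ℝ) (ξ : Stt n) (μ : Stt m), t ∈ γ l → χ ‖μ‖ ≤ Vm l t ξ →
    V l t (ξ + g l t ξ μ) ≤ al l t (Vm l t ξ)) ∧
  (∀ (l : Λ) (t : ℝ) (ξ : Stt n) (μ : Stt m), t ∈ γ l → Vm l t ξ ≤ χ ‖μ‖ →
    V l t (ξ + g l t ξ μ) ≤ π ‖μ‖)

/-- Solution of the scalar comparison differential/difference inclusion. -/
structure IsCompSol (γ : Set ℝ) (vφ al : ℝ → ℝ → ℝ) (t0 z0 : ℝ) (T : EReal)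
    (z : ℝ → ℝ) : Prop where
  lt : (t0 : EReal) < T
  init : z t0 = z0
  nonneg : ∀ t : ℝ, t0 ≤ t → (t : EReal) < T → 0 ≤ z t
  flow : ∀ t1 t2 : ℝ, t0 ≤ t1 → t1 ≤ t2 → (t2 : EReal) < T → Set.Ioc t1 t2 ∩ γ = ∅ →
    ∃ d : ℝ → ℝ, MeasureTheory.IntegrableOn d (Set.Icc t1 t2) ∧
      (∀ᵐ s ∂MeasureTheory.volume, s ∈ Set.Icc t1 t2 → d s ≤ - vφ s (z s)) ∧
      ∀ t ∈ Set.Icc t1 t2, z t = z t1 + ∫ s in t1..t, d s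
  jump : ∀ t ∈ γ, t0 < t → (t : EReal) < T →
    ∃ L : ℝ, Filter.Tendsto z (nhdsWithin t (Set.Iio t)) (nhds L) ∧ z t ≤ al t L

/-- The family of comparison systems is weakly GUAS. -/
def CompWeakGUAS {Λ : Type*} (γ : Λ → Set ℝ) (vφ al : Λ → ℝ → ℝ → ℝ) : Prop :=
  ∃ β : ℝ → ℝ → ℝ, ClassKL β ∧
    ∀ (l : Λ) (t0 z0 : ℝ) (T : EReal) (z : ℝ → ℝ), 0 ≤ t0 → 0 ≤ z0 →
      IsCompSol (γ l) (vφ l) (al l) t0 z0 T z →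
      ∀ t : ℝ, t0 ≤ t → (t : EReal) < T → z t ≤ β z0 (t - t0)

/-- The family of comparison systems is strongly GUAS. -/
def CompStrongGUAS {Λ : Type*} (γ : Λ → Set ℝ) (vφ al : Λ → ℝ → ℝ → ℝ) : Prop :=
  ∃ β : ℝ → ℝ → ℝ, ClassKL β ∧
    ∀ (l : Λ) (t0 z0 : ℝ) (T : EReal) (z : ℝ → ℝ), 0 ≤ t0 → 0 ≤ z0 →
      IsCompSol (γ l) (vφ l) (al l) t0 z0 T z →
      ∀ t : ℝ, t0 ≤ t → (t : EReal) < T → z t ≤ β z0 (t - t0 + (nJumps (γ l) t0 t : ℝ))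

/-- Nonnegative Carathéodory solution of the scalar ODE `ẇ = rhs(t,w)` on `[t0,T)`. -/
structure IsODESol (rhs : ℝ → ℝ → ℝ) (t0 : ℝ) (T : EReal) (w : ℝ → ℝ) : Prop where
  lt : (t0 : EReal) < T
  nonneg : ∀ t : ℝ, t0 ≤ t → (t : EReal) < T → 0 ≤ w t
  flow : ∀ t1 t2 : ℝ, t0 ≤ t1 → t1 ≤ t2 → (t2 : EReal) < T →
    IntervalIntegrable (fun s => rhs s (w s)) MeasureTheory.volume t1 t2 ∧
    w t2 = w t1 + ∫ s in t1..t2, rhs s (w s)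

/-- Maximally defined forward-in-time solution of `ẇ = rhs(t,w)`. -/
def IsMaxODESol (rhs : ℝ → ℝ → ℝ) (t0 : ℝ) (T : EReal) (w : ℝ → ℝ) : Prop :=
  IsODESol rhs t0 T w ∧
    ∀ (T' : EReal) (w' : ℝ → ℝ), IsODESol rhs t0 T' w' →
      (∀ t : ℝ, t0 ≤ t → (t : EReal) < T → w' t = w t) → T' ≤ T

/-- GUAS of the family of scalar ODEs `ẇ = −φ_λ(t,w)`. -/
def ODEFamilyGUAS {Λ : Type*} (vφ : Λ → ℝ → ℝ → ℝ) : Prop :=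
  ∃ β : ℝ → ℝ → ℝ, ClassKL β ∧
    ∀ (l : Λ) (t0 : ℝ) (T : EReal) (w : ℝ → ℝ), 0 ≤ t0 →
      IsMaxODESol (fun s r => -(vφ l s r)) t0 T w →
      T = (⊤ : EReal) ∧ ∀ t : ℝ, t0 ≤ t → w t ≤ β (w t0) (t - t0)

/-- Solution (on all of `[0,∞)`) of the scalar linear ODE `ẇ = −p(t)·w`. -/
def IsLinSol (p : ℝ → ℝ) (w : ℝ → ℝ) : Prop :=
  ∀ t1 t2 : ℝ, 0 ≤ t1 → t1 ≤ t2 →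
    IntervalIntegrable (fun s => p s * w s) MeasureTheory.volume t1 t2 ∧
    w t2 = w t1 + ∫ s in t1..t2, -(p s * w s)

/-- An impulsive and switching sequence, described through its impulse-time set,
its two switching signals (constant between impulses), and the left limit of the
first switching signal at impulse times. -/
structure SwSignal (Ic Id : Type*) where
  γ : Set ℝ
  σ1 : ℝ → Ic
  σ1m : ℝ → Ic
  σ2 : ℝ → Id
  impulse : IsImpulseSeq γ
  const1 : ∀ a b : ℝ, 0 ≤ a → Set.Ioo a b ∩ γ = ∅ → ∀ t ∈ Set.Ico a b, σ1 t = σ1 a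
  const2 : ∀ a b : ℝ, 0 ≤ a → Set.Ioo a b ∩ γ = ∅ → ∀ t ∈ Set.Ico a b, σ2 t = σ2 a
  leftlim : ∀ t ∈ γ, ∀ᶠ s in nhdsWithin t (Set.Iio t), σ1 s = σ1m t

/-- `σ ∈ SW(J)`. -/
def InSW {Ic Id : Type*} (σ : SwSignal Ic Id) (J : Set (Ic × Ic × Id)) : Prop :=
  ∀ t ∈ σ.γ, (σ.σ1m t, σ.σ1 t, σ.σ2 t) ∈ J

/-- Flow map of the switched impulsive system `Σ_σ`. -/
def swF {n m : ℕ} {Ic Id : Type*} (F : Ic → ℝ → Stt n → Stt m → Stt n)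
    (σ : SwSignal Ic Id) : ℝ → Stt n → Stt m → Stt n :=
  fun t ξ μ => F (σ.σ1 t) t ξ μ

/-- Jump map of the switched impulsive system `Σ_σ`. -/
def swG {n m : ℕ} {Ic Id : Type*} (G : Id → ℝ → Stt n → Stt m → Stt n)
    (σ : SwSignal Ic Id) : ℝ → Stt n → Stt m → Stt n :=
  fun t ξ μ => G (σ.σ2 t) t ξ μ

/-- Weak `(h⁰,h)`-ISS of the family `{Σ_σ}_{σ ∈ SW}`. -/
def SwWeaklyISS {n m : ℕ} {Ic Id : Type*} (F : Ic → ℝ → Stt n → Stt m → Stt n)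
    (G : Id → ℝ → Stt n → Stt m → Stt n) (SW : Set (SwSignal Ic Id))
    (h0 h : ℝ → Stt n → ℝ) : Prop :=
  ∃ β : ℝ → ℝ → ℝ, ∃ ρ : ℝ → ℝ, ClassKL β ∧ ClassKInf ρ ∧
    ∀ σ ∈ SW, ∀ (t0 : ℝ) (x0 : Stt n) (u : ℝ → Stt m) (T : EReal) (x : ℝ → Stt n),
      0 ≤ t0 → IsInput u → IsMaxSolution σ.γ (swF F σ) (swG G σ) t0 x0 u T x →
      ∀ t : ℝ, t0 ≤ t → (t : EReal) < T →
        h t (x t) ≤ β (h0 t0 x0) (t - t0) + ρ (inputNorm σ.γ u (Set.Ioc t0 t))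

/-- Strong `(h⁰,h)`-ISS of the family `{Σ_σ}_{σ ∈ SW}`. -/
def SwStronglyISS {n m : ℕ} {Ic Id : Type*} (F : Ic → ℝ → Stt n → Stt m → Stt n)
    (G : Id → ℝ → Stt n → Stt m → Stt n) (SW : Set (SwSignal Ic Id))
    (h0 h : ℝ → Stt n → ℝ) : Prop :=
  ∃ β : ℝ → ℝ → ℝ, ∃ ρ : ℝ → ℝ, ClassKL β ∧ ClassKInf ρ ∧
    ∀ σ ∈ SW, ∀ (t0 : ℝ) (x0 : Stt n) (u : ℝ → Stt m) (T : EReal) (x : ℝ → Stt n),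
      0 ≤ t0 → IsInput u → IsMaxSolution σ.γ (swF F σ) (swG G σ) t0 x0 u T x →
      ∀ t : ℝ, t0 ≤ t → (t : EReal) < T →
        h t (x t) ≤ β (h0 t0 x0) (t - t0 + (nJumps σ.γ t0 t : ℝ)) +
          ρ (inputNorm σ.γ u (Set.Ioc t0 t))

/-- Total activation time in `(t0,t]` of the flow modes in `A`. -/
def actT {Ic Id : Type*} (σ : SwSignal Ic Id) (A : Set Ic) (t0 t : ℝ) : ℝ :=
  (MeasureTheory.volume {r : ℝ | r ∈ Set.Ioc t0 t ∧ σ.σ1 r ∈ A}).toReal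

/-- Number of impulse times in `(t0,t]` whose mode combination lies in `Jp`. -/
def nJumpsIn {Ic Id : Type*} (σ : SwSignal Ic Id) (Jp : Set (Ic × Ic × Id))
    (t0 t : ℝ) : ℕ :=
  (σ.γ ∩ Set.Ioc t0 t ∩ {r : ℝ | (σ.σ1m r, σ.σ1 r, σ.σ2 r) ∈ Jp}).ncard

/-- Assumption 2 of the paper (for switched impulsive systems), data explicit. -/
def Assumption2 {n m : ℕ} {Ic Id : Type*}
    (F : Ic → ℝ → Stt n → Stt m → Stt n) (G : Id → ℝ → Stt n → Stt m → Stt n)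
    (h0 h : ℝ → Stt n → ℝ) (J : Set (Ic × Ic × Id))
    (v : Ic → ℝ → Stt n → ℝ) (φ1 φ2 χ π : ℝ → ℝ)
    (vφ : Ic → ℝ → ℝ → ℝ) (al : Ic × Ic × Id → ℝ → ℝ → ℝ) : Prop :=
  ClassKInf φ1 ∧ ClassKInf φ2 ∧ ClassKInf χ ∧ ClassKInf π ∧
  (∀ i : Ic, LocLipschitzOn ((Set.Ici (0 : ℝ)) ×ˢ (Set.univ : Set (Stt n)))
      (fun q : ℝ × Stt n => v i q.1 q.2)) ∧
  (∀ i : Ic, Caratheodory2 (vφ i)) ∧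
  (∀ e ∈ J, ∀ t r : ℝ, 0 ≤ t → 0 ≤ r → 0 ≤ al e t r) ∧
  (∀ (i : Ic) (t : ℝ) (ξ : Stt n), 0 ≤ t →
    φ1 (h t ξ) ≤ v i t ξ ∧ v i t ξ ≤ φ2 (h0 t ξ)) ∧
  (∀ (i : Ic) (t : ℝ) (ξ : Stt n) (μ : Stt m), 0 ≤ t → χ ‖μ‖ ≤ v i t ξ →
    DiniAlong (F i) (v i) t ξ μ ≤ - vφ i t (v i t ξ)) ∧
  (∀ (ι i : Ic) (j : Id), (ι, i, j) ∈ J → ∀ (t : ℝ) (ξ : Stt n) (μ : Stt m),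
    0 ≤ t → χ ‖μ‖ ≤ v ι t ξ → v i t (ξ + G j t ξ μ) ≤ al (ι, i, j) t (v ι t ξ)) ∧
  (∀ (ι i : Ic) (j : Id), (ι, i, j) ∈ J → ∀ (t : ℝ) (ξ : Stt n) (μ : Stt m),
    0 ≤ t → v ι t ξ ≤ χ ‖μ‖ → v i t (ξ + G j t ξ μ) ≤ π ‖μ‖)

/-- One step of the delayed Picard iteration for `ẇ = F(t,w)`, `w(a) = w0`. -/
def delayedPicard (F : ℝ → ℝ → ℝ) (a w0 δ : ℝ) : ℕ → ℝ → ℝ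
  | 0 => fun _ => w0
  | j + 1 => fun t => w0 + ∫ s in a..max a (t - δ), F s (delayedPicard F a w0 δ j s)

lemma integrable_comp_of_bound {F : ℝ → ℝ → ℝ} {m : ℝ → ℝ}
    (hmeas : ∀ w : ℝ → ℝ, Continuous w → AEStronglyMeasurable (fun s => F s (w s)) volume)
    (hm : Integrable m) (hb : ∀ s y, |F s y| ≤ m s) {w : ℝ → ℝ} (hw : Continuous w) :
    Integrable fun s => F s (w s) :=
  hm.mono' (hmeas w hw) (Eventually.of_forall fun s => hb s (w s))

lemma continuous_delayedPicard {F : ℝ → ℝ → ℝ} {m : ℝ → ℝ} {a w0 δ : ℝ}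
    (hmeas : ∀ w : ℝ → ℝ, Continuous w → AEStronglyMeasurable (fun s => F s (w s)) volume)
    (hm : Integrable m) (hb : ∀ s y, |F s y| ≤ m s) (j : ℕ) :
    Continuous (delayedPicard F a w0 δ j) := by
  induction j with
  | zero => exact continuous_const
  | succ j ih =>
    have h1 := intervalIntegral.continuous_primitive
      (fun c d => (integrable_comp_of_bound hmeas hm hb ih).intervalIntegrable (a := c) (b := d)) a
    exact continuous_const.add
      (h1.comp (continuous_const.max (continuous_id.sub continuous_const)))

lemma delayedPicard_succ_eq {F : ℝ → ℝ → ℝ} {a w0 δ : ℝ} (hδ : 0 < δ) (j : ℕ) :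
    ∀ t, t ≤ a + j * δ → delayedPicard F a w0 δ (j + 1) t = delayedPicard F a w0 δ j t := by
  induction j with
  | zero =>
    intro t ht
    have : max a (t - δ) = a := max_eq_left (by simp at ht; linarith)
    simp [delayedPicard, this]
  | succ j ih =>
    intro t ht
    push_cast at ht
    change w0 + _ = w0 + _
    congr 1
    refine intervalIntegral.integral_congr fun s hs => ?_
    rw [uIcc_of_le (le_max_left _ _)] at hs
    have : s ≤ a + j * δ :=
      hs.2.trans (max_le (by nlinarith [(Nat.cast_nonneg j : (0 : ℝ) ≤ j)]) (by linarith))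
    simp only [ih s this]

/-- Approximate solutions with an arbitrarily small delay. -/
lemma exists_delayed_solution {F : ℝ → ℝ → ℝ} {m : ℝ → ℝ} {a b w0 δ : ℝ}
    (hmeas : ∀ w : ℝ → ℝ, Continuous w → AEStronglyMeasurable (fun s => F s (w s)) volume)
    (hm : Integrable m) (hb : ∀ s y, |F s y| ≤ m s) (hδ : 0 < δ) :
    ∃ w : ℝ → ℝ, Continuous w ∧
      ∀ t ≤ b, w t = w0 + ∫ s in a..max a (t - δ), F s (w s) := by
  obtain ⟨j, hj⟩ := exists_nat_ge ((b - a) / δ)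
  refine ⟨_, continuous_delayedPicard (w0 := w0) (δ := δ) (a := a) hmeas hm hb j, fun t ht => ?_⟩
  rw [div_le_iff₀ hδ] at hj
  exact (delayedPicard_succ_eq hδ j t (by linarith)).symm

lemma abs_integral_le_abs_primitive_sub {f m : ℝ → ℝ} (hm : Integrable m)
    (hb : ∀ s, |f s| ≤ m s) (a s t : ℝ) :
    |∫ r in s..t, f r| ≤ |(∫ r in a..t, m r) - ∫ r in a..s, m r| := by
  rw [intervalIntegral.integral_interval_sub_left hm.intervalIntegrable hm.intervalIntegrable]
  exact intervalIntegral.norm_integral_le_abs_of_norm_le (f := f)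
    (Eventually.of_forall fun r => hb r) hm.intervalIntegrable

/-- Carathéodory existence theorem for scalar equations with integrably bounded right-hand side. -/
lemma exists_caratheodory_solution_of_integrable {F : ℝ → ℝ → ℝ} {m : ℝ → ℝ} {a b : ℝ} (w0 : ℝ)
    (hab : a ≤ b) (hc : ∀ s, Continuous (F s))
    (hmeas : ∀ w : ℝ → ℝ, Continuous w → AEStronglyMeasurable (fun s => F s (w s)) volume)
    (hm : Integrable m) (hb : ∀ s y, |F s y| ≤ m s) :
    ∃ w : ℝ → ℝ, Continuous w ∧ ∀ t ∈ Icc a b, w t = w0 + ∫ s in a..t, F s (w s) := by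
  have hδ : ∀ k : ℕ, (0 : ℝ) < 1 / ((k : ℝ) + 1) := fun k => Nat.one_div_pos_of_nat
  choose y hyc hy using fun k : ℕ =>
    exists_delayed_solution (a := a) (b := b) (w0 := w0) hmeas hm hb (hδ k)
  set M : ℝ → ℝ := fun t => ∫ r in a..t, m r with hM
  have hMc : Continuous M :=
    intervalIntegral.continuous_primitive (fun _ _ => hm.intervalIntegrable) a
  set τ : ℕ → ℝ → ℝ := fun k t => max a (t - 1 / ((k : ℝ) + 1)) with hτ
  have hτm : ∀ k t, t ∈ Icc a b → τ k t ∈ Icc a b := fun k t ht =>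
    ⟨le_max_left _ _, max_le hab (by linarith [hδ k, ht.2])⟩
  have hyd : ∀ k s t, s ∈ Icc a b → t ∈ Icc a b → |y k t - y k s| ≤ |M (τ k t) - M (τ k s)| := by
    intro k s t hs ht
    have hi := integrable_comp_of_bound hmeas hm hb (hyc k)
    rw [hy k t ht.2, hy k s hs.2, add_sub_add_left_eq_sub,
      intervalIntegral.integral_interval_sub_left hi.intervalIntegrable hi.intervalIntegrable]
    exact abs_integral_le_abs_primitive_sub hm (fun s => hb s _) a _ _
  have hya : ∀ k, y k a = w0 := by
    intro k
    have : max a (a - 1 / ((k : ℝ) + 1)) = a := max_eq_left (by linarith [hδ k])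
    rw [hy k a hab, this]
    simp
  have : CompactSpace (Icc a b) := isCompact_iff_compactSpace.1 isCompact_Icc
  let Y : ℕ → BoundedContinuousFunction (Icc a b) ℝ := fun k =>
    BoundedContinuousFunction.mkOfCompact ⟨fun t => y k t, (hyc k).comp continuous_subtype_val⟩
  have hYv : ∀ k t, Y k t = y k t := fun _ _ => rfl
  have hMu := isCompact_Icc.uniformContinuousOn_of_continuous (hMc.continuousOn (s := Icc a b))
  rw [Metric.uniformContinuousOn_iff] at hMu
  obtain ⟨B, hB⟩ := (isCompact_Icc.image_of_continuousOn (hMc.continuousOn (s := Icc a b))).isBounded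
    |>.exists_norm_le
  have hMa : M a = 0 := by simp [hM]
  have hcpt : IsCompact (closure (range Y)) := by
    refine BoundedContinuousFunction.arzela_ascoli (Icc (w0 - B) (w0 + B)) isCompact_Icc _ ?_ ?_
    · rintro _ t ⟨k, rfl⟩
      have h1 := hyd k a t ⟨le_rfl, hab⟩ t.2
      have h2 : τ k a = a := max_eq_left (by linarith [hδ k])
      rw [hya, h2, hMa, sub_zero] at h1
      have h3 := h1.trans (hB _ (mem_image_of_mem M (hτm k t t.2)))
      rw [abs_le] at h3
      rw [hYv]
      constructor <;> linarith
    · refine UniformEquicontinuous.equicontinuous ?_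
      rw [Metric.uniformEquicontinuous_iff]
      intro ε hε
      obtain ⟨δ, hδ0, hδM⟩ := hMu ε hε
      refine ⟨δ, hδ0, ?_⟩
      rintro s t hst ⟨_, k, rfl⟩
      change dist (y k s) (y k t) < ε
      refine (hyd k t s t.2 s.2).trans_lt (hδM _ (hτm k s s.2) _ (hτm k t t.2) ?_)
      refine lt_of_le_of_lt ?_ hst
      rw [Subtype.dist_eq, Real.dist_eq, Real.dist_eq]
      refine (abs_max_sub_max_le_max _ _ _ _).trans ?_
      simp
  obtain ⟨W, -, ψ, hψ, hlim⟩ := hcpt.tendsto_subseq fun k => subset_closure (mem_range_self k)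
  have hpt : ∀ t : Icc a b, Tendsto (fun k => y (ψ k) t) atTop (nhds (W t)) := fun t =>
    ((continuous_eval_const t).tendsto W).comp hlim
  refine ⟨IccExtend hab W, W.continuous.Icc_extend', fun t ht => ?_⟩
  have hWt : ∀ s (hs : s ∈ Icc a b), IccExtend hab W s = W ⟨s, hs⟩ := fun s hs =>
    IccExtend_of_mem hab W hs
  have hdom : Tendsto (fun k => ∫ s in a..t, F s (y (ψ k) s)) atTop
      (nhds (∫ s in a..t, F s (IccExtend hab W s))) := by
    refine intervalIntegral.tendsto_integral_filter_of_dominated_convergence m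
      (Eventually.of_forall fun k => (hmeas _ (hyc _)).restrict)
      (Eventually.of_forall fun k => Eventually.of_forall fun s _ => hb s _)
      hm.intervalIntegrable (Eventually.of_forall fun s hs => ?_)
    rw [uIoc_of_le ht.1] at hs
    have hs' : s ∈ Icc a b := ⟨hs.1.le, hs.2.trans ht.2⟩
    rw [hWt s hs']
    exact (hc s).continuousAt.tendsto.comp (hpt ⟨s, hs'⟩)
  have hτt : Tendsto (fun k => τ (ψ k) t) atTop (nhds t) := by
    have h1 : Tendsto (fun k : ℕ => max a (t - 1 / ((k : ℝ) + 1))) atTop (nhds (max a (t - 0))) :=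
      tendsto_const_nhds.max (tendsto_const_nhds.sub tendsto_one_div_add_atTop_nhds_zero_nat)
    rw [sub_zero, max_eq_right ht.1] at h1
    exact h1.comp hψ.tendsto_atTop
  have hrest : Tendsto (fun k => ∫ s in (τ (ψ k) t)..t, F s (y (ψ k) s)) atTop (nhds 0) := by
    have h1 : Tendsto (fun k => |M t - M (τ (ψ k) t)|) atTop (nhds 0) := by
      have := (tendsto_const_nhds (x := M t)).sub ((hMc.tendsto t).comp hτt)
      simpa using this.abs
    exact squeeze_zero_norm (fun k => abs_integral_le_abs_primitive_sub hm (fun s => hb s _) a _ _) h1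
  have hfin : Tendsto (fun k => y (ψ k) t) atTop
      (nhds (w0 + (∫ s in a..t, F s (IccExtend hab W s)) - 0)) := by
    refine ((tendsto_const_nhds.add hdom).sub hrest).congr fun k => ?_
    have hi := integrable_comp_of_bound hmeas hm hb (hyc (ψ k))
    have h1 := intervalIntegral.integral_add_adjacent_intervals (μ := volume)
      (hi.intervalIntegrable (a := a) (b := τ (ψ k) t)) (hi.intervalIntegrable (b := t))
    have h2 := hy (ψ k) t ht.2
    change y (ψ k) t = w0 + ∫ s in a..τ (ψ k) t, F s (y (ψ k) s) at h2
    linarith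
  rw [sub_zero] at hfin
  rw [hWt t ht]
  exact tendsto_nhds_unique (hpt ⟨t, ht⟩) hfin

/-- Carathéodory existence theorem for scalar equations on a compact interval. -/
lemma exists_caratheodory_solution {F : ℝ → ℝ → ℝ} {m : ℝ → ℝ} {a b : ℝ} (w0 : ℝ)
    (hab : a ≤ b) (hc : ∀ s, Continuous (F s))
    (hmeas : ∀ w : ℝ → ℝ, Continuous w →
      AEStronglyMeasurable (fun s => F s (w s)) (volume.restrict (Icc a b)))
    (hm : IntegrableOn m (Icc a b)) (hb : ∀ s ∈ Icc a b, ∀ y, |F s y| ≤ m s) :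
    ∃ w : ℝ → ℝ, Continuous w ∧ ∀ t ∈ Icc a b, w t = w0 + ∫ s in a..t, F s (w s) := by
  set G : ℝ → ℝ → ℝ := fun s y => (Icc a b).indicator (fun s => F s y) s with hG
  have hGF : ∀ s ∈ Icc a b, ∀ y, G s y = F s y := fun s hs y => by simp only [hG, indicator_of_mem hs]
  have hG0 : ∀ s ∉ Icc a b, ∀ y, G s y = 0 := fun s hs y => by simp only [hG, indicator_of_notMem hs]
  have hGc : ∀ s, Continuous (G s) := by
    intro s
    by_cases hs : s ∈ Icc a b
    · exact (hc s).congr fun y => (hGF s hs y).symm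
    · exact continuous_const.congr fun y => (hG0 s hs y).symm
  have hGm : ∀ w : ℝ → ℝ, Continuous w → AEStronglyMeasurable (fun s => G s (w s)) volume :=
    fun w hw => (aestronglyMeasurable_indicator_iff measurableSet_Icc).2 (hmeas w hw)
  have hGb : ∀ s y, |G s y| ≤ (Icc a b).indicator m s := by
    intro s y
    by_cases hs : s ∈ Icc a b
    · rw [indicator_of_mem hs, hGF s hs]
      exact hb s hs y
    · rw [indicator_of_notMem hs, hG0 s hs, abs_zero]
  obtain ⟨w, hw, h⟩ := exists_caratheodory_solution_of_integrable w0 hab hGc hGm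
    (hm.integrable_indicator measurableSet_Icc) hGb
  refine ⟨w, hw, fun t ht => ?_⟩
  rw [h t ht, add_right_inj]
  refine intervalIntegral.integral_congr fun s hs => ?_
  rw [uIcc_of_le ht.1] at hs
  exact hGF s ⟨hs.1, hs.2.trans ht.2⟩ (w s)

/-- Every solution of a scalar equation extends to a maximally defined one. -/
lemma exists_isMaxODESol {rhs : ℝ → ℝ → ℝ} {t0 : ℝ} {T : EReal} {w : ℝ → ℝ}
    (hw : IsODESol rhs t0 T w) :
    ∃ (T' : EReal) (w' : ℝ → ℝ), IsMaxODESol rhs t0 T' w' ∧ T ≤ T' ∧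
      ∀ t : ℝ, t0 ≤ t → (t : EReal) < T → w' t = w t := by
  let S := {p : EReal × (ℝ → ℝ) // IsODESol rhs t0 p.1 p.2 ∧ T ≤ p.1 ∧
    ∀ t : ℝ, t0 ≤ t → (t : EReal) < T → p.2 t = w t}
  let r : S → S → Prop := fun p q => p.1.1 ≤ q.1.1 ∧
    ∀ t : ℝ, t0 ≤ t → (t : EReal) < p.1.1 → q.1.2 t = p.1.2 t
  have htrans : ∀ {p q s : S}, r p q → r q s → r p s := fun {p q s} h1 h2 =>
    ⟨h1.1.trans h2.1, fun t ht htp => (h2.2 t ht (htp.trans_le h1.1)).trans (h1.2 t ht htp)⟩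
  have hchain : ∀ c : Set S, IsChain r c → ∃ ub, ∀ p ∈ c, r p ub := by
    intro c hc
    rcases c.eq_empty_or_nonempty with rfl | ⟨p0, hp0⟩
    · exact ⟨⟨(T, w), hw, le_rfl, fun _ _ _ => rfl⟩, by simp⟩
    have hagree : ∀ p ∈ c, ∀ q ∈ c, ∀ t : ℝ, t0 ≤ t → (t : EReal) < p.1.1 →
        (t : EReal) < q.1.1 → p.1.2 t = q.1.2 t := by
      intro p hp q hq t ht htp htq
      by_cases hpq : p = q
      · rw [hpq]
      rcases hc hp hq hpq with h1 | h1
      · exact (h1.2 t ht htp).symm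
      · exact h1.2 t ht htq
    let Tm : EReal := sSup ((fun p : S => p.1.1) '' c)
    have hle : ∀ p ∈ c, p.1.1 ≤ Tm := fun p hp => le_sSup (mem_image_of_mem _ hp)
    have hex : ∀ t : ℝ, (t : EReal) < Tm → ∃ p ∈ c, (t : EReal) < p.1.1 := by
      intro t ht
      obtain ⟨_, ⟨p, hp, rfl⟩, hlt⟩ := lt_sSup_iff.1 ht
      exact ⟨p, hp, hlt⟩
    let wm : ℝ → ℝ := fun t =>
      if ht : ∃ p ∈ c, (t : EReal) < p.1.1 then ht.choose.1.2 t else 0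
    have hwm : ∀ p ∈ c, ∀ t : ℝ, t0 ≤ t → (t : EReal) < p.1.1 → wm t = p.1.2 t := by
      intro p hp t ht htp
      have he : ∃ p ∈ c, (t : EReal) < p.1.1 := ⟨p, hp, htp⟩
      have : wm t = he.choose.1.2 t := dif_pos he
      rw [this]
      exact hagree _ he.choose_spec.1 p hp t ht he.choose_spec.2 htp
    have hsol : IsODESol rhs t0 Tm wm := by
      refine ⟨p0.2.1.lt.trans_le (hle p0 hp0), fun t ht htT => ?_, fun t1 t2 h1 h2 h2T => ?_⟩
      · obtain ⟨p, hp, htp⟩ := hex t htT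
        rw [hwm p hp t ht htp]
        exact p.2.1.nonneg t ht htp
      · obtain ⟨p, hp, htp⟩ := hex t2 h2T
        have hlt : ∀ s : ℝ, s ≤ t2 → (s : EReal) < p.1.1 := fun s hs =>
          (EReal.coe_le_coe_iff.2 hs).trans_lt htp
        have heq : EqOn (fun s => rhs s (wm s)) (fun s => rhs s (p.1.2 s)) (uIcc t1 t2) := by
          intro s hs
          rw [uIcc_of_le h2] at hs
          simp only [hwm p hp s (h1.trans hs.1) (hlt s hs.2)]
        obtain ⟨hi, he⟩ := p.2.1.flow t1 t2 h1 h2 htp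
        rw [hwm p hp t1 h1 (hlt t1 h2), hwm p hp t2 (h1.trans h2) htp,
          intervalIntegral.integral_congr heq]
        exact ⟨hi.congr (heq.symm.mono uIoc_subset_uIcc), he⟩
    refine ⟨⟨(Tm, wm), hsol, p0.2.2.1.trans (hle p0 hp0), fun t ht htT => ?_⟩, fun p hp =>
      ⟨hle p hp, hwm p hp⟩⟩
    exact (hwm p0 hp0 t ht (htT.trans_le p0.2.2.1)).trans (p0.2.2.2 t ht htT)
  obtain ⟨p, hp⟩ := exists_maximal_of_chains_bounded hchain htrans
  refine ⟨p.1.1, p.1.2, ⟨p.2.1, fun T' w' hw' hag => ?_⟩, p.2.2⟩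
  by_contra! hlt
  have := hp ⟨(T', w'), hw', p.2.2.1.trans hlt.le, fun t ht htT =>
    (hag t ht (htT.trans_le p.2.2.1)).trans (p.2.2.2 t ht htT)⟩ ⟨hlt.le, hag⟩
  exact absurd this.1 (not_le.2 hlt)

/-- Under the GUAS estimate, a nonnegative solution on a compact interval obeys the estimate at the
right endpoint. -/
lemma le_of_compact_solution {rhs β : ℝ → ℝ → ℝ} {a b : ℝ} {w : ℝ → ℝ}
    (hG : ∀ (T : EReal) (w : ℝ → ℝ), IsMaxODESol rhs a T w →
      T = (⊤ : EReal) ∧ ∀ t : ℝ, a ≤ t → w t ≤ β (w a) (t - a))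
    (hab : a < b) (hw0 : ∀ t ∈ Icc a b, 0 ≤ w t)
    (hi : IntervalIntegrable (fun s => rhs s (w s)) volume a b)
    (hw : ∀ t ∈ Icc a b, w t = w a + ∫ s in a..t, rhs s (w s)) :
    ∀ t ∈ Icc a b, w t ≤ β (w a) (t - a) := by
  have hmono : ∀ c d, a ≤ c → c ≤ d → d ≤ b →
      IntervalIntegrable (fun s => rhs s (w s)) volume c d := fun c d h1 h2 h3 =>
    hi.mono_set (by rw [uIcc_of_le h2, uIcc_of_le hab.le]; exact Icc_subset_Icc h1 h3)
  have hsol : IsODESol rhs a b w := by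
    refine ⟨EReal.coe_lt_coe_iff.2 hab, fun t ht htb => ?_, fun t1 t2 h1 h2 h3 => ?_⟩
    · exact hw0 t ⟨ht, (EReal.coe_lt_coe_iff.1 htb).le⟩
    · have h3 := (EReal.coe_lt_coe_iff.1 h3).le
      refine ⟨hmono t1 t2 h1 h2 h3, ?_⟩
      rw [hw t1 ⟨h1, h2.trans h3⟩, hw t2 ⟨h1.trans h2, h3⟩, add_assoc,
        intervalIntegral.integral_add_adjacent_intervals (hmono a t1 le_rfl h1 (h2.trans h3))
          (hmono t1 t2 h1 h2 h3)]
  obtain ⟨T', w', hmax, -, hag⟩ := exists_isMaxODESol hsol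
  obtain ⟨rfl, hle⟩ := hG T' w' hmax
  have hwa : w' a = w a := hag a le_rfl (EReal.coe_lt_coe_iff.2 hab)
  intro t ht
  rw [← hwa]
  refine le_of_eq_of_le ?_ (hle t ht.1)
  rw [(hmax.1.flow a t le_rfl ht.1 (EReal.coe_lt_top t)).2, hw t ht, hwa, add_right_inj]
  refine intervalIntegral.integral_congr_Ioo_of_le ht.1 fun s hs => ?_
  simp only [hag s hs.1.le (EReal.coe_lt_coe_iff.2 (hs.2.trans_le ht.2))]

/-- Integral comparison principle: a subsolution that may jump downwards stays below an absolutely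
continuous function that grows at least as fast wherever it is smaller. -/
lemma le_of_integral_subsolution {v w d e : ℝ → ℝ} {a b : ℝ} (hab : a ≤ b)
    (hd : IntervalIntegrable d volume a b) (he : IntervalIntegrable e volume a b)
    (hv : ∀ t1 t2, a ≤ t1 → t1 ≤ t2 → t2 ≤ b → v t2 ≤ v t1 + ∫ s in t1..t2, d s)
    (hw : ∀ t ∈ Icc a b, w t = w a + ∫ s in a..t, e s)
    (hde : ∀ s ∈ Icc a b, w s < v s → d s ≤ e s) (hva : v a ≤ w a) : v b ≤ w b := by
  set A : Set ℝ := {s | s ∈ Icc a b ∧ v s ≤ w s} with hA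
  have haA : a ∈ A := ⟨⟨le_rfl, hab⟩, hva⟩
  have hAb : BddAbove A := ⟨b, fun s hs => hs.1.2⟩
  set σ := sSup A with hσ
  have hσI : σ ∈ Icc a b := ⟨le_csSup hAb haA, csSup_le ⟨a, haA⟩ fun s hs => hs.1.2⟩
  have hsub : ∀ f : ℝ → ℝ, IntervalIntegrable f volume a b → ∀ c d, c ∈ Icc a b → d ∈ Icc a b →
      IntervalIntegrable f volume c d := fun f hf c d hc hd => hf.mono_set (by
    rw [uIcc_of_le hab]; exact uIcc_subset_Icc hc hd)
  have hbI : b ∈ Icc a b := ⟨hab, le_rfl⟩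
  have haI : a ∈ Icc a b := ⟨le_rfl, hab⟩
  have hprim : ∀ f : ℝ → ℝ, IntervalIntegrable f volume a b →
      ContinuousOn (fun t => ∫ s in a..t, f s) (Icc a b) := fun f hf => by
    have := intervalIntegral.continuousOn_primitive_interval (μ := volume) (f := f) (a := a) (b := b)
      (by rw [uIcc_of_le hab]; exact (intervalIntegrable_iff_integrableOn_Icc_of_le hab).1 hf)
    rwa [uIcc_of_le hab] at this
  set Q : ℝ → ℝ := fun t => (w a + ∫ s in a..t, e s) + ((∫ s in a..b, d s) - ∫ s in a..t, d s)
  have hQc : ContinuousOn Q (Icc a b) :=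
    (continuousOn_const.add (hprim e he)).add (continuousOn_const.sub (hprim d hd))
  have hQA : ∀ s ∈ A, v b ≤ Q s := by
    intro s hs
    have h1 := hv s b hs.1.1 hs.1.2 le_rfl
    have h2 := intervalIntegral.integral_add_adjacent_intervals (hsub d hd a s haI hs.1)
      (hsub d hd s b hs.1 hbI)
    have h3 := hw s hs.1
    have h4 := hs.2
    simp only [Q]
    linarith
  have hQσ : v b ≤ Q σ := by
    have hcl : σ ∈ closure A := csSup_mem_closure ⟨a, haA⟩ hAb
    have hne : (nhdsWithin σ A).NeBot := mem_closure_iff_nhdsWithin_neBot.1 hcl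
    have hlim : Tendsto Q (nhdsWithin σ A) (nhds (Q σ)) :=
      (hQc σ hσI).mono fun s hs => hs.1
    exact ge_of_tendsto hlim (eventually_mem_nhdsWithin.mono hQA)
  have hmon : ∫ s in σ..b, d s ≤ ∫ s in σ..b, e s := by
    refine intervalIntegral.integral_mono_on_of_le_Ioo hσI.2 (hsub d hd σ b hσI hbI)
      (hsub e he σ b hσI hbI) fun s hs => ?_
    have hsI : s ∈ Icc a b := ⟨hσI.1.trans hs.1.le, hs.2.le⟩
    refine hde s hsI ?_
    by_contra! hle
    exact absurd (le_csSup hAb (⟨hsI, hle⟩ : s ∈ A)) (not_le.2 hs.1)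
  have h1 := intervalIntegral.integral_add_adjacent_intervals (hsub d hd a σ haI hσI)
    (hsub d hd σ b hσI hbI)
  have h2 := intervalIntegral.integral_add_adjacent_intervals (hsub e he a σ haI hσI)
    (hsub e he σ b hσI hbI)
  have h3 := hw b hbI
  simp only [Q] at hQσ
  linarith

lemma Caratheodory2.aestronglyMeasurable_comp {φ : ℝ → ℝ → ℝ} (hφ : Caratheodory2 φ)
    {μ : Measure ℝ} {y : ℝ → ℝ} (hy : AEMeasurable y μ) :
    AEStronglyMeasurable (fun s => φ s (max 0 (y s))) μ := by
  have hu : Measurable (Function.uncurry fun r s => φ s (max 0 r)) :=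
    measurable_uncurry_of_continuous_of_measurable
      (fun s => (hφ.2.1 s).comp_continuous (continuous_const.max continuous_id)
        fun r => le_max_left 0 r) (fun r => hφ.1 _)
  exact (hu.comp_aemeasurable (hy.prodMk aemeasurable_id)).aestronglyMeasurable

lemma Caratheodory2.integrableOn_comp {φ : ℝ → ℝ → ℝ} (hφ : Caratheodory2 φ) {a b C : ℝ}
    {v : ℝ → ℝ} (hv : AEMeasurable v (volume.restrict (Icc a b)))
    (hv0 : ∀ t ∈ Icc a b, 0 ≤ v t) (hvC : ∀ t ∈ Icc a b, v t ≤ C) :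
    IntegrableOn (fun s => -(φ s (v s))) (Icc a b) := by
  obtain ⟨m, hm, hb⟩ := hφ.2.2 a b C
  have h1 : IntegrableOn (fun s => -(φ s (max 0 (v s)))) (Icc a b) := by
    refine hm.mono' (hφ.aestronglyMeasurable_comp hv).neg
      ((ae_restrict_mem measurableSet_Icc).mono fun s hs => ?_)
    rw [norm_neg]
    exact hb s hs _ ⟨le_max_left _ _, max_le ((hv0 s hs).trans (hvC s hs)) (hvC s hs)⟩
  refine h1.congr_fun (fun s hs => ?_) measurableSet_Icc
  simp only [max_eq_right (hv0 s hs)]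

/-- A subsolution is dominated by the GUAS bound. -/
lemma le_of_guas_of_subsolution {φ β : ℝ → ℝ → ℝ} {a b C w0 : ℝ} {v : ℝ → ℝ}
    (hφ : Caratheodory2 φ) (hβ : ClassKL β)
    (hG : ∀ (T : EReal) (w : ℝ → ℝ), IsMaxODESol (fun s r => -(φ s r)) a T w →
      T = (⊤ : EReal) ∧ ∀ t : ℝ, a ≤ t → w t ≤ β (w a) (t - a))
    (hab : a < b) (hv0 : ∀ t ∈ Icc a b, 0 ≤ v t) (hvC : ∀ t ∈ Icc a b, v t ≤ C)
    (hvm : AEMeasurable v (volume.restrict (Icc a b)))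
    (hv : ∀ t1 t2, a ≤ t1 → t1 ≤ t2 → t2 ≤ b → v t2 ≤ v t1 + ∫ s in t1..t2, -(φ s (v s)))
    (hva : v a ≤ w0) :
    w0 ≤ β w0 0 ∧ ∀ t ∈ Icc a b, v t ≤ β w0 (t - a) := by
  have haI : a ∈ Icc a b := ⟨le_rfl, hab.le⟩
  have hw00 : 0 ≤ w0 := (hv0 a haI).trans hva
  set c : ℝ := max (max C w0) (β w0 0) + 1 with hc
  have hcC : C < c := by
    linarith [le_max_left (max C w0) (β w0 0), le_max_left C w0]
  have hcw : w0 < c := by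
    linarith [le_max_left (max C w0) (β w0 0), le_max_right C w0]
  have hcβ : β w0 0 < c := by linarith [le_max_right (max C w0) (β w0 0)]
  have hc0 : 0 ≤ c := hw00.trans hcw.le
  set F : ℝ → ℝ → ℝ := fun s y => -(φ s (max 0 (min c (max y (v s))))) with hF
  have hFc : ∀ s, Continuous (F s) := fun s =>
    ((hφ.2.1 s).comp_continuous (continuous_const.max
      (continuous_const.min (continuous_id.max continuous_const)))
        fun r => mem_Ici.2 (le_max_left _ _)).neg
  have hFm : ∀ w : ℝ → ℝ, Continuous w →
      AEStronglyMeasurable (fun s => F s (w s)) (volume.restrict (Icc a b)) := fun w hw =>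
    (hφ.aestronglyMeasurable_comp
      (aemeasurable_const.min (hw.aemeasurable.max hvm))).neg
  obtain ⟨m, hm, hmb⟩ := hφ.2.2 a b c
  have hFb : ∀ s ∈ Icc a b, ∀ y, |F s y| ≤ m s := fun s hs y => by
    rw [hF, abs_neg]
    exact hmb s hs _ ⟨le_max_left _ _, max_le hc0 (min_le_left _ _)⟩
  obtain ⟨w, hwc, hw⟩ := exists_caratheodory_solution w0 hab.le hFc hFm hm hFb
  have hwa : w a = w0 := by rw [hw a haI]; simp
  have hFi : IntegrableOn (fun s => F s (w s)) (Icc a b) :=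
    hm.mono' (hFm w hwc) ((ae_restrict_mem measurableSet_Icc).mono fun s hs => hFb s hs _)
  have hFint : ∀ t ∈ Icc a b, IntervalIntegrable (fun s => F s (w s)) volume a t := fun t ht =>
    (intervalIntegrable_iff_integrableOn_Icc_of_le ht.1).2
      (hFi.mono_set (Icc_subset_Icc le_rfl ht.2))
  have hvint : ∀ t ∈ Icc a b, IntervalIntegrable (fun s => -(φ s (v s))) volume a t := fun t ht =>
    (intervalIntegrable_iff_integrableOn_Icc_of_le ht.1).2
      ((hφ.integrableOn_comp hvm hv0 hvC).mono_set (Icc_subset_Icc le_rfl ht.2))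
  have hvw : ∀ t ∈ Icc a b, v t ≤ w t := by
    intro t ht
    refine le_of_integral_subsolution ht.1 (hvint t ht) (hFint t ht)
      (fun t1 t2 h1 h2 h3 => hv t1 t2 h1 h2 (h3.trans ht.2))
      (fun s hs => by rw [hwa]; exact hw s ⟨hs.1, hs.2.trans ht.2⟩) (fun s hs hlt => ?_)
      (hva.trans_eq hwa.symm)
    have hsI : s ∈ Icc a b := ⟨hs.1, hs.2.trans ht.2⟩
    simp only [hF, max_eq_right hlt.le, min_eq_right ((hvC s hsI).trans hcC.le),
      max_eq_right (hv0 s hsI), le_refl]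
  have hw0 : ∀ t ∈ Icc a b, 0 ≤ w t := fun t ht => (hv0 t ht).trans (hvw t ht)
  have hFeq : ∀ s ∈ Icc a b, w s ≤ c → F s (w s) = -(φ s (w s)) := fun s hs hsc => by
    simp only [hF, max_eq_left (hvw s hs), min_eq_right hsc, max_eq_right (hw0 s hs)]
  have hbound : ∀ τ ∈ Icc a b, a < τ → (∀ s ∈ Ico a τ, w s ≤ c) →
      ∀ t ∈ Icc a τ, w t ≤ β w0 (t - a) := by
    intro τ hτ haτ hle
    have hcong : ∀ t ∈ Icc a τ, EqOn (fun s => F s (w s)) (fun s => -(φ s (w s))) (Ioo a t) :=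
      fun t ht s hs => hFeq s ⟨hs.1.le, hs.2.le.trans (ht.2.trans hτ.2)⟩
        (hle s ⟨hs.1.le, hs.2.trans_le ht.2⟩)
    have hi : IntervalIntegrable (fun s => -(φ s (w s))) volume a τ := by
      have h1 := hFint τ hτ
      rw [intervalIntegrable_iff_integrableOn_Ioo_of_le haτ.le] at h1 ⊢
      exact h1.congr_fun (hcong τ ⟨haτ.le, le_rfl⟩) measurableSet_Ioo
    rw [← hwa]
    refine le_of_compact_solution hG haτ (fun t ht => hw0 t ⟨ht.1, ht.2.trans hτ.2⟩) hi
      fun t ht => ?_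
    rw [hwa, hw t ⟨ht.1, ht.2.trans hτ.2⟩,
      intervalIntegral.integral_congr_Ioo_of_le ht.1 (hcong t ht)]
  have hwlt : ∀ t ∈ Icc a b, w t < c := by
    by_contra! hex
    obtain ⟨t, ht, hct⟩ := hex
    have hcpt : IsCompact {s | s ∈ Icc a b ∧ c ≤ w s} :=
      isCompact_Icc.inter_right (isClosed_le continuous_const hwc)
    obtain ⟨τ, ⟨hτI, hτc⟩, hτmin⟩ := hcpt.exists_isLeast ⟨t, ht, hct⟩
    have haτ : a < τ := by
      refine lt_of_le_of_ne hτI.1 fun h => ?_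
      rw [← h, hwa] at hτc
      linarith
    have h1 := hbound τ hτI haτ (fun s hs => by
      by_contra! hlt
      exact absurd (hτmin ⟨⟨hs.1, hs.2.le.trans hτI.2⟩, hlt.le⟩) (not_le.2 hs.2)) τ ⟨haτ.le, le_rfl⟩
    have h2 : β w0 (τ - a) ≤ β w0 0 :=
      (hβ.2 w0 hw00).1 (mem_Ici.2 le_rfl) (mem_Ici.2 (by linarith)) (by linarith)
    linarith
  have hfin := hbound b ⟨hab.le, le_rfl⟩ hab fun s hs => (hwlt s ⟨hs.1, hs.2.le⟩).le
  refine ⟨?_, fun t ht => (hvw t ht).trans (hfin t ht)⟩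
  have := hfin a haI
  rwa [hwa, sub_self] at this


section AlongCurve

variable {E : Type*} [NormedAddCommGroup E] [NormedSpace ℝ E]

theorem dist_le_of_eq_add_integral {x F : ℝ → E} {a b : ℝ}
    (hF : IntegrableOn F (Icc a b)) (hx : ∀ t ∈ Icc a b, x t = x a + ∫ s in a..t, F s)
    {s t : ℝ} (hs : s ∈ Icc a b) (ht : t ∈ Icc a b) :
    dist (x s) (x t) ≤ dist (∫ r in a..s, ‖F r‖) (∫ r in a..t, ‖F r‖) := by
  have hi : ∀ r ∈ Icc a b, IntervalIntegrable F volume a r := fun r hr =>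
    (intervalIntegrable_iff_integrableOn_Icc_of_le hr.1).2
      (hF.mono_set (Icc_subset_Icc le_rfl hr.2))
  rw [hx s hs, hx t ht, dist_add_left, dist_eq_norm, Real.dist_eq,
    intervalIntegral.integral_interval_sub_left (hi s hs) (hi t ht),
    intervalIntegral.integral_interval_sub_left (hi s hs).norm (hi t ht).norm]
  exact intervalIntegral.norm_integral_le_abs_integral_norm

theorem continuousOn_of_eq_add_integral {x F : ℝ → E} {a b : ℝ}
    (hF : IntegrableOn F (Icc a b)) (hx : ∀ t ∈ Icc a b, x t = x a + ∫ s in a..t, F s) :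
    ContinuousOn x (Icc a b) :=
  (continuousOn_const.add (intervalIntegral.continuousOn_primitive hF |>.congr fun _ ht =>
    intervalIntegral.integral_of_le ht.1)).congr hx

theorem absolutelyContinuousOnInterval_comp_curve {W : ℝ × E → ℝ} {x F : ℝ → E} {a b : ℝ}
    (hab : a ≤ b) (hF : IntegrableOn F (Icc a b))
    (hx : ∀ t ∈ Icc a b, x t = x a + ∫ s in a..t, F s)
    (hW : LocLipschitzOn (Icc a b ×ˢ univ) W) :
    AbsolutelyContinuousOnInterval (fun t => W (t, x t)) a b := by
  have hxc := continuousOn_of_eq_add_integral hF hx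
  have hcomp : IsCompact ((fun t => (t, x t)) '' Icc a b) :=
    isCompact_Icc.image_of_continuousOn (continuousOn_id.prodMk hxc)
  have hsub : (fun t => (t, x t)) '' Icc a b ⊆ Icc a b ×ˢ univ := by
    rintro _ ⟨t, ht, rfl⟩
    exact ⟨ht, mem_univ _⟩
  have hWl : LocallyLipschitzOn (Icc a b ×ˢ univ) W := fun q hq => hW q hq
  obtain ⟨K, hK⟩ := (hWl.mono hsub).exists_lipschitzOnWith_of_compact hcomp
  have hint : IntervalIntegrable (fun r => ‖F r‖) volume a b :=
    ((intervalIntegrable_iff_integrableOn_Icc_of_le hab).2 hF).norm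
  have h1 := hint.absolutelyContinuousOnInterval_intervalIntegral (left_mem_uIcc)
  have h2 : AbsolutelyContinuousOnInterval (fun t : ℝ => t) a b :=
    (LipschitzWith.id.lipschitzOnWith (s := uIcc a b)).absolutelyContinuousOnInterval
  have h3 : Tendsto (fun I : ℕ × (ℕ → ℝ × ℝ) =>
      (K : ℝ) * (∑ i ∈ Finset.range I.1, dist (I.2 i).1 (I.2 i).2 +
        ∑ i ∈ Finset.range I.1, dist (∫ r in a..(I.2 i).1, ‖F r‖) (∫ r in a..(I.2 i).2, ‖F r‖)))
      (AbsolutelyContinuousOnInterval.totalLengthFilter ⊓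
        𝓟 (AbsolutelyContinuousOnInterval.disjWithin a b)) (nhds 0) := by
    simpa using (Tendsto.add h2 h1).const_mul (K : ℝ)
  refine squeeze_zero' (.of_forall fun I => Finset.sum_nonneg fun _ _ => dist_nonneg) ?_ h3
  filter_upwards [eventually_inf_principal.2 (.of_forall fun I hI => hI)] with I hI
  rw [← Finset.sum_add_distrib, Finset.mul_sum]
  refine Finset.sum_le_sum fun i hi => ?_
  obtain ⟨m1, m2⟩ := hI.1 i hi
  rw [uIcc_of_le hab] at m1 m2
  refine (hK.dist_le_mul _ (mem_image_of_mem _ m1) _ (mem_image_of_mem _ m2)).trans ?_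
  refine mul_le_mul_of_nonneg_left ?_ K.2
  rw [Prod.dist_eq]
  exact max_le (le_add_of_nonneg_right dist_nonneg)
    ((dist_le_of_eq_add_integral hF hx m1 m2).trans (le_add_of_nonneg_left dist_nonneg))

theorem tendsto_slope_comp_curve {W : ℝ × E → ℝ} {x : ℝ → E} {p : E} {w s : ℝ}
    (hW : ∃ K : NNReal, ∃ t ∈ nhds (s, x s), LipschitzOnWith K W t)
    (hx : HasDerivAt x p s) (hw : HasDerivAt (fun t => W (t, x t)) w s) :
    Tendsto (fun d : ℝ => (W (s + d, x s + d • p) - W (s, x s)) / d)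
      (nhdsWithin 0 (Ioi 0)) (nhds w) := by
  obtain ⟨K, N, hN, hK⟩ := hW
  have hle : nhdsWithin (0 : ℝ) (Ioi 0) ≤ nhdsWithin 0 {0}ᶜ :=
    nhdsWithin_mono _ fun d hd => ne_of_gt hd
  have h1 := (hasDerivAt_iff_tendsto_slope_zero.1 hw).mono_left hle
  have h2 := (hasDerivAt_iff_tendsto_slope_zero.1 hx).mono_left hle
  have h3 : Tendsto (fun d : ℝ => (K : ℝ) * ‖p - d⁻¹ • (x (s + d) - x s)‖)
      (nhdsWithin 0 (Ioi 0)) (nhds 0) := by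
    simpa using ((tendsto_const_nhds (x := p)).sub h2).norm.const_mul (K : ℝ)
  have hadd : Tendsto (fun d : ℝ => s + d) (nhdsWithin 0 (Ioi 0)) (nhds s) := by
    have : Tendsto (fun d : ℝ => s + d) (nhds 0) (nhds (s + 0)) :=
      (continuous_const.add continuous_id).tendsto 0
    rw [add_zero] at this
    exact this.mono_left nhdsWithin_le_nhds
  have e1 : Tendsto (fun d : ℝ => (s + d, x s + d • p)) (nhdsWithin 0 (Ioi 0))
      (nhds (s, x s)) := by
    refine hadd.prodMk_nhds ?_
    have : Tendsto (fun d : ℝ => x s + d • p) (nhds 0) (nhds (x s + (0 : ℝ) • p)) :=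
      (continuous_const.add (continuous_id.smul continuous_const)).tendsto 0
    rw [zero_smul, add_zero] at this
    exact this.mono_left nhdsWithin_le_nhds
  have e2 : Tendsto (fun d : ℝ => (s + d, x (s + d))) (nhdsWithin 0 (Ioi 0))
      (nhds (s, x s)) := hadd.prodMk_nhds (hx.continuousAt.tendsto.comp hadd)
  have h4 : Tendsto (fun d : ℝ => (W (s + d, x s + d • p) - W (s + d, x (s + d))) / d)
      (nhdsWithin 0 (Ioi 0)) (nhds 0) := by
    refine squeeze_zero_norm' ?_ h3
    filter_upwards [e1 hN, e2 hN, self_mem_nhdsWithin] with d m1 m2 hd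
    have hd' : (0 : ℝ) < d := hd
    have := hK.dist_le_mul _ m1 _ m2
    rw [Prod.dist_eq, dist_self, max_eq_right dist_nonneg, dist_eq_norm, dist_eq_norm] at this
    rw [norm_div, Real.norm_of_nonneg hd'.le, div_le_iff₀ hd']
    refine this.trans_eq ?_
    have : x s + d • p - x (s + d) = d • (p - d⁻¹ • (x (s + d) - x s)) := by
      rw [smul_sub, smul_inv_smul₀ hd'.ne']
      abel
    rw [this, norm_smul, Real.norm_of_nonneg hd'.le]
    ring
  have h5 := h4.add h1
  rw [zero_add] at h5
  refine h5.congr fun d => ?_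
  simp only [smul_eq_mul]
  ring

end AlongCurve

theorem le_add_integral_of_diniAlong_le {n m : ℕ} {f : ℝ → Stt n → Stt m → Stt n}
    {V : ℝ → Stt n → ℝ} {x : ℝ → Stt n} {u : ℝ → Stt m} {D : ℝ → ℝ} {a b : ℝ} (hab : a ≤ b)
    (hF : IntegrableOn (fun s => f s (x s) (u s)) (Icc a b))
    (hx : ∀ t ∈ Icc a b, x t = x a + ∫ s in a..t, f s (x s) (u s))
    (hV : LocLipschitzOn (Icc a b ×ˢ univ) (fun q : ℝ × Stt n => V q.1 q.2))
    (hD : IntegrableOn D (Icc a b))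
    (hle : ∀ᵐ s, s ∈ Ioo a b → DiniAlong f V s (x s) (u s) ≤ D s) :
    V b (x b) ≤ V a (x a) + ∫ s in a..b, D s := by
  have hac : AbsolutelyContinuousOnInterval (fun t => V t (x t)) a b :=
    absolutelyContinuousOnInterval_comp_curve (W := fun q : ℝ × Stt n => V q.1 q.2) hab hF hx hV
  have hFi : IntervalIntegrable (fun s => f s (x s) (u s)) volume a b :=
    (intervalIntegrable_iff_integrableOn_Icc_of_le hab).2 hF
  have hDi : IntervalIntegrable D volume a b :=
    (intervalIntegrable_iff_integrableOn_Icc_of_le hab).2 hD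
  have key := hac.integral_deriv_eq_sub
  have hmono : ∫ s in a..b, deriv (fun t => V t (x t)) s ≤ ∫ s in a..b, D s := by
    refine intervalIntegral.integral_mono_ae_restrict hab hac.intervalIntegrable_deriv hDi ?_
    rw [← restrict_Ioo_eq_restrict_Icc]
    rw [EventuallyLE, ae_restrict_iff' measurableSet_Ioo]
    filter_upwards [hle, hac.ae_differentiableAt, hFi.ae_hasDerivAt_integral] with s h1 h2 h3 hs
    have hsI : s ∈ uIcc a b := by rw [uIcc_of_le hab]; exact Ioo_subset_Icc_self hs
    refine le_of_eq_of_le ?_ (h1 hs)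
    have hnh : Icc a b ∈ nhds s := Icc_mem_nhds hs.1 hs.2
    have hxd : HasDerivAt x (f s (x s) (u s)) s :=
      ((h3 hsI a left_mem_uIcc).const_add (x a)).congr_of_eventuallyEq
        (eventually_of_mem hnh hx)
    have hWs : ∃ K : NNReal, ∃ t ∈ nhds (s, x s),
        LipschitzOnWith K (fun q : ℝ × Stt n => V q.1 q.2) t := by
      obtain ⟨K, t, ht, hK⟩ := hV (s, x s) ⟨Ioo_subset_Icc_self hs, mem_univ _⟩
      rw [nhdsWithin_eq_nhds.2 (prod_mem_nhds hnh univ_mem)] at ht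
      exact ⟨K, t, ht, hK⟩
    exact (tendsto_slope_comp_curve hWs hxd (h2 hsI).hasDerivAt).limsup_eq.symm
  linarith

theorem IsImpulseSeq.eventually_notMem {γ : Set ℝ} (hγ : IsImpulseSeq γ) (t : ℝ) :
    ∃ ε > 0, ∀ s ∈ γ, |s - t| < ε → s = t := by
  have hfin : ((γ ∩ Iic (t + 1)) \ {t}).Finite := (hγ.2 (t + 1)).sdiff
  have hn : ((γ ∩ Iic (t + 1)) \ {t})ᶜ ∈ nhds t :=
    hfin.isClosed.isOpen_compl.mem_nhds fun h => h.2 rfl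
  obtain ⟨ε, hε, hb⟩ := Metric.mem_nhds_iff.1 hn
  refine ⟨min ε 1, lt_min hε one_pos, fun s hs hst => ?_⟩
  by_contra hne
  have h1 : |s - t| < ε := hst.trans_le (min_le_left _ _)
  have h2 : |s - t| < 1 := hst.trans_le (min_le_right _ _)
  exact hb (by rwa [Metric.mem_ball, Real.dist_eq])
    ⟨⟨hs, mem_Iic.2 (by linarith [le_abs_self (s - t)])⟩, hne⟩

theorem InClassV.locLipschitzOn_Icc {n : ℕ} {γ : Set ℝ} {V Vm : ℝ → Stt n → ℝ}
    (hγ : IsImpulseSeq γ) (hV : InClassV γ V Vm) {a b : ℝ} (ha : 0 ≤ a)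
    (hj : Ioc a b ∩ γ = ∅) :
    LocLipschitzOn (Icc a b ×ˢ (univ : Set (Stt n))) (fun q : ℝ × Stt n => V q.1 q.2) := by
  obtain ⟨ε, hε, hb⟩ := hγ.eventually_notMem b
  have hj' : Ioo a (b + ε) ∩ γ = ∅ := by
    refine eq_empty_of_forall_notMem fun s hs => ?_
    rcases le_or_gt s b with h | h
    · exact eq_empty_iff_forall_notMem.1 hj s ⟨⟨hs.1.1, h⟩, hs.2⟩
    · have := hb s hs.2 (by rw [abs_of_pos (by linarith)]; linarith [hs.1.2])
      linarith
  have hl : LocallyLipschitzOn (Ico a (b + ε) ×ˢ univ) (fun q : ℝ × Stt n => V q.1 q.2) :=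
    fun q hq => hV.1 a (b + ε) ha hj' q hq
  have hs : Icc a b ×ˢ (univ : Set (Stt n)) ⊆ Ico a (b + ε) ×ˢ univ :=
    prod_mono (fun s hs => ⟨hs.1, by linarith [hs.2]⟩) subset_rfl
  exact fun q hq => hl.mono hs hq

namespace IsSolution

variable {n m : ℕ} {γ : Set ℝ} {f g : ℝ → Stt n → Stt m → Stt n} {t0 : ℝ} {x0 : Stt n}
  {u : ℝ → Stt m} {T : EReal} {x : ℝ → Stt n} {V Vm : ℝ → Stt n → ℝ}

theorem eq_add_integral (hs : IsSolution γ f g t0 x0 u T x) {a b : ℝ} (ha : t0 ≤ a)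
    (hbT : (b : EReal) < T) (hj : Ioc a b ∩ γ = ∅) :
    ∀ t ∈ Icc a b, x t = x a + ∫ s in a..t, f s (x s) (u s) := fun t ht =>
  (hs.flow a t ha ht.1 ((EReal.coe_le_coe_iff.2 ht.2).trans_lt hbT)
    (subset_empty_iff.1 ((inter_subset_inter_left _
      (Ioc_subset_Ioc_right ht.2)).trans hj.subset))).2

theorem continuousOn_comp (hs : IsSolution γ f g t0 x0 u T x) (hγ : IsImpulseSeq γ)
    (hV : InClassV γ V Vm) (ht0 : 0 ≤ t0) {a b : ℝ} (ha : t0 ≤ a) (hab : a ≤ b)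
    (hbT : (b : EReal) < T) (hj : Ioc a b ∩ γ = ∅) :
    ContinuousOn (fun t => V t (x t)) (Icc a b) := by
  have hx := continuousOn_of_eq_add_integral (hs.flow a b ha hab hbT hj).1
    (hs.eq_add_integral ha hbT hj)
  have hl : LocallyLipschitzOn (Icc a b ×ˢ univ) (fun q : ℝ × Stt n => V q.1 q.2) :=
    fun q hq => hV.locLipschitzOn_Icc hγ (ht0.trans ha) hj q hq
  exact hl.continuousOn.comp (continuousOn_id.prodMk hx) fun t ht => ⟨ht, mem_univ _⟩

theorem continuousWithinAt_Ici_comp (hs : IsSolution γ f g t0 x0 u T x) (hγ : IsImpulseSeq γ)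
    (hV : InClassV γ V Vm) (ht0 : 0 ≤ t0) {s : ℝ} (h0s : t0 ≤ s) (hsT : (s : EReal) < T) :
    ContinuousWithinAt (fun t => V t (x t)) (Ici s) s := by
  obtain ⟨ε, hε, hb⟩ := hγ.eventually_notMem s
  obtain ⟨c, hc1, hc2⟩ := EReal.lt_iff_exists_real_btwn.1 hsT
  have hsc : s < c := EReal.coe_lt_coe_iff.1 hc1
  set b := min c (s + ε / 2) with hbdef
  have hsb : s < b := lt_min hsc (by linarith)
  have hj : Ioc s b ∩ γ = ∅ := by
    refine eq_empty_of_forall_notMem fun r hr => ?_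
    have h1 : r ≤ s + ε / 2 := hr.1.2.trans (min_le_right _ _)
    have := hb r hr.2 (by rw [abs_of_pos (by linarith [hr.1.1])]; linarith)
    linarith [hr.1.1]
  have hbT : (b : EReal) < T := (EReal.coe_le_coe_iff.2 (min_le_left _ _)).trans_lt hc2
  have := hs.continuousOn_comp hγ hV ht0 h0s hsb.le hbT hj s ⟨le_rfl, hsb.le⟩
  exact this.mono_of_mem_nhdsWithin (Icc_mem_nhdsGE hsb)

theorem continuousAt_comp (hs : IsSolution γ f g t0 x0 u T x) (hγ : IsImpulseSeq γ)
    (hV : InClassV γ V Vm) (ht0 : 0 ≤ t0) {s : ℝ} (h0s : t0 < s) (hsT : (s : EReal) < T)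
    (hsγ : s ∉ γ) : ContinuousAt (fun t => V t (x t)) s := by
  refine continuousAt_iff_continuous_left_right.2
    ⟨?_, hs.continuousWithinAt_Ici_comp hγ hV ht0 h0s.le hsT⟩
  obtain ⟨ε, hε, hb⟩ := hγ.eventually_notMem s
  set a := max t0 (s - ε / 2) with hadef
  have has : a < s := max_lt h0s (by linarith)
  have hj : Ioc a s ∩ γ = ∅ := by
    refine eq_empty_of_forall_notMem fun r hr => ?_
    have h1 : s - ε / 2 < r := (le_max_right _ _).trans_lt hr.1.1
    have := hb r hr.2 (by rw [abs_of_nonpos (by linarith [hr.1.2])]; linarith)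
    exact hsγ (this ▸ hr.2)
  have := hs.continuousOn_comp hγ hV ht0 (le_max_left _ _) has.le hsT hj s ⟨has.le, le_rfl⟩
  exact this.mono_of_mem_nhdsWithin (Icc_mem_nhdsLE has)

theorem tendsto_left_comp (hs : IsSolution γ f g t0 x0 u T x) (hV : InClassV γ V Vm)
    {τ : ℝ} (hτ : τ ∈ γ) (h0τ : t0 < τ) (hτT : (τ : EReal) < T) :
    ∃ L : Stt n, Tendsto (fun t => V t (x t)) (nhdsWithin τ (Iio τ)) (nhds (Vm τ L)) ∧
      x τ = L + g τ L (u τ) := by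
  obtain ⟨L, hL, hx⟩ := hs.jump τ hτ h0τ hτT
  refine ⟨L, (hV.2 τ hτ L).comp (tendsto_nhdsWithin_iff.2
    ⟨(tendsto_nhdsWithin_of_tendsto_nhds tendsto_id).prodMk_nhds hL, ?_⟩), hx⟩
  filter_upwards [self_mem_nhdsWithin] with t ht using ⟨ht, mem_univ _⟩

theorem exists_tendsto_left_comp (hs : IsSolution γ f g t0 x0 u T x) (hγ : IsImpulseSeq γ)
    (hV : InClassV γ V Vm) (ht0 : 0 ≤ t0) {s : ℝ} (h0s : t0 < s) (hsT : (s : EReal) < T) :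
    ∃ L : ℝ, Tendsto (fun t => V t (x t)) (nhdsWithin s (Iio s)) (nhds L) := by
  by_cases h : s ∈ γ
  · obtain ⟨L, hL, -⟩ := hs.tendsto_left_comp hV h h0s hsT
    exact ⟨_, hL⟩
  · exact ⟨_, (hs.continuousAt_comp hγ hV ht0 h0s hsT h).tendsto.mono_left nhdsWithin_le_nhds⟩

end IsSolution

theorem exists_le_of_regulated {v : ℝ → ℝ} {a b : ℝ}
    (hr : ∀ s ∈ Icc a b, ContinuousWithinAt v (Ici s) s)
    (hl : ∀ s ∈ Ioc a b, ∃ L, Tendsto v (nhdsWithin s (Iio s)) (nhds L)) :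
    ∃ C, ∀ t ∈ Icc a b, v t ≤ C := by
  refine isCompact_Icc.induction_on (p := fun S => ∃ C, ∀ t ∈ S, v t ≤ C) ⟨0, by simp⟩
    (fun S S' hSS ⟨C, hC⟩ => ⟨C, fun t ht => hC t (hSS ht)⟩)
    (fun S S' ⟨C, hC⟩ ⟨C', hC'⟩ => ⟨max C C', fun t ht => ht.elim
      (fun h => (hC t h).trans (le_max_left _ _))
      fun h => (hC' t h).trans (le_max_right _ _)⟩) fun s hs => ?_
  have h1 : ∀ᶠ t in nhdsWithin s (Ici s), v t < v s + 1 :=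
    (hr s hs).eventually (gt_mem_nhds (lt_add_one _))
  rcases hs.1.eq_or_lt with rfl | has
  · exact ⟨_, nhdsWithin_mono _ Icc_subset_Ici_self h1, v a + 1, fun t ht => le_of_lt ht⟩
  · obtain ⟨L, hL⟩ := hl s ⟨has, hs.2⟩
    have h2 : ∀ᶠ t in nhdsWithin s (Iio s), v t < L + 1 :=
      hL.eventually (gt_mem_nhds (lt_add_one _))
    have h3 : ∀ᶠ t in nhds s, v t ≤ max (v s + 1) (L + 1) := by
      rw [← nhdsLT_sup_nhdsGE, eventually_sup]
      exact ⟨h2.mono fun t ht => ht.le.trans (le_max_right _ _),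
        h1.mono fun t ht => ht.le.trans (le_max_left _ _)⟩
    exact ⟨_, mem_nhdsWithin_of_mem_nhds h3, _, fun t ht => ht⟩

theorem le_add_integral_of_jumps {v D : ℝ → ℝ} {γ : Set ℝ} {a b : ℝ}
    (hfin : (γ ∩ Iic b).Finite) (hD : IntegrableOn D (Icc a b))
    (hflow : ∀ t1 t2, a ≤ t1 → t1 ≤ t2 → t2 ≤ b → Ioc t1 t2 ∩ γ = ∅ →
      v t2 ≤ v t1 + ∫ s in t1..t2, D s)
    (hjump : ∀ τ ∈ γ ∩ Ioc a b, ∃ L, Tendsto v (nhdsWithin τ (Iio τ)) (nhds L) ∧ v τ ≤ L)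
    {t1 t2 : ℝ} (h1 : a ≤ t1) (h12 : t1 ≤ t2) (h2 : t2 ≤ b) :
    v t2 ≤ v t1 + ∫ s in t1..t2, D s := by
  have hDi : ∀ r1 r2, a ≤ r1 → r1 ≤ r2 → r2 ≤ b → IntervalIntegrable D volume r1 r2 :=
    fun r1 r2 h1 h2 h3 => (intervalIntegrable_iff_integrableOn_Icc_of_le h2).2
      (hD.mono_set (Icc_subset_Icc h1 h3))
  have hfin' : ∀ t ≤ b, (Ioc t1 t ∩ γ).Finite := fun t ht =>
    hfin.subset fun s hs => ⟨hs.2, hs.1.2.trans ht⟩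
  induction hk : (Ioc t1 t2 ∩ γ).ncard using Nat.strong_induction_on generalizing t2 with
  | _ k ih =>
  rcases (Ioc t1 t2 ∩ γ).eq_empty_or_nonempty with he | hne
  · exact hflow t1 t2 h1 h12 h2 he
  obtain ⟨τ, hτ, hmax⟩ := exists_max_image _ id (hfin' t2 h2) hne
  obtain ⟨L, hL, hvL⟩ := hjump τ ⟨hτ.2, h1.trans_lt hτ.1.1, hτ.1.2.trans h2⟩
  have hτb := hτ.1.2.trans h2
  have hbefore : ∀ s ∈ Ico t1 τ, v s ≤ v t1 + ∫ r in t1..s, D r := fun s hs => by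
    refine ih (Ioc t1 s ∩ γ).ncard ?_ hs.1 (hs.2.le.trans hτb) rfl
    rw [← hk]
    refine ncard_lt_ncard ⟨fun r hr => ⟨⟨hr.1.1, hr.1.2.trans (hs.2.le.trans hτ.1.2)⟩, hr.2⟩,
      fun hsub => ?_⟩ (hfin' t2 h2)
    exact absurd (hsub hτ).1.2 (not_le.2 hs.2)
  have hcont : Tendsto (fun s => v t1 + ∫ r in t1..s, D r) (nhdsWithin τ (Iio τ))
      (nhds (v t1 + ∫ r in t1..τ, D r)) := by
    refine tendsto_const_nhds.add ?_
    have := intervalIntegral.continuousOn_primitive_interval (μ := volume) (f := D)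
      (a := t1) (b := τ) (by
        rw [uIcc_of_le hτ.1.1.le]
        exact hD.mono_set (Icc_subset_Icc h1 hτb))
    rw [uIcc_of_le hτ.1.1.le] at this
    have h3 := this τ ⟨hτ.1.1.le, le_rfl⟩
    exact h3.tendsto.mono_left (nhdsWithin_le_of_mem
      (mem_of_superset (Ico_mem_nhdsLT hτ.1.1) Ico_subset_Icc_self))
  have hτle : L ≤ v t1 + ∫ r in t1..τ, D r := by
    have : (nhdsWithin τ (Iio τ)).NeBot := inferInstance
    exact le_of_tendsto_of_tendsto hL hcont
      (eventually_of_mem (Ico_mem_nhdsLT hτ.1.1) hbefore)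
  have hafter := hflow τ t2 (h1.trans hτ.1.1.le) hτ.1.2 h2
    (eq_empty_of_forall_notMem fun s hs =>
      absurd (hmax s ⟨⟨hτ.1.1.trans hs.1.1, hs.1.2⟩, hs.2⟩) (not_le.2 hs.1.1))
  rw [← intervalIntegral.integral_add_adjacent_intervals (hDi t1 τ h1 hτ.1.1.le hτb)
    (hDi τ t2 (h1.trans hτ.1.1.le) hτ.1.2 h2)]
  linarith

theorem ClassKInf.nonneg {α : ℝ → ℝ} (hα : ClassKInf α) {r : ℝ} (hr : 0 ≤ r) : 0 ≤ α r :=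
  hα.2.2.1.symm.trans_le (hα.2.1.monotoneOn self_mem_Ici hr hr)

theorem ClassKInf.mono {α : ℝ → ℝ} (hα : ClassKInf α) {r s : ℝ} (hr : 0 ≤ r) (hrs : r ≤ s) :
    α r ≤ α s :=
  hα.2.1.monotoneOn hr (hr.trans hrs) hrs

theorem IsSolution.le_of_guas {n m : ℕ} {γ : Set ℝ} {f g : ℝ → Stt n → Stt m → Stt n} {t0 : ℝ}
    {x0 : Stt n} {u : ℝ → Stt m} {T : EReal} {x : ℝ → Stt n} {V Vm : ℝ → Stt n → ℝ}
    {χ : ℝ → ℝ} {φ β : ℝ → ℝ → ℝ}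
    (hs : IsSolution γ f g t0 x0 u T x) (hγ : IsImpulseSeq γ) (hV : InClassV γ V Vm)
    (ht0 : 0 ≤ t0) (hχ : ClassKInf χ) (hφ : Caratheodory2 φ) (hβ : ClassKL β)
    (hV0 : ∀ t ξ, 0 ≤ t → 0 ≤ V t ξ)
    (hflow : ∀ t ξ μ, 0 ≤ t → t ∉ γ → χ ‖μ‖ ≤ V t ξ → DiniAlong f V t ξ μ ≤ -φ t (V t ξ))
    (hjump : ∀ t ξ μ, t ∈ γ → χ ‖μ‖ ≤ Vm t ξ → V t (ξ + g t ξ μ) ≤ Vm t ξ)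
    {a b r w0 : ℝ} (ha : t0 ≤ a) (hab : a < b) (hbT : (b : EReal) < T)
    (hG : ∀ T w, IsMaxODESol (fun s r => -(φ s r)) a T w →
      T = ⊤ ∧ ∀ t, a ≤ t → w t ≤ β (w a) (t - a))
    (hge : ∀ s ∈ Ioc a b, χ r ≤ V s (x s)) (hu : ∀ᵐ s, s ∈ Ioc a b → ‖u s‖ ≤ r)
    (huj : ∀ τ ∈ γ ∩ Ioc a b, ‖u τ‖ ≤ r) (hw0 : V a (x a) ≤ w0) :
    ∀ t ∈ Icc a b, V t (x t) ≤ β w0 (t - a) := by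
  have hT : ∀ {t : ℝ}, t ≤ b → (t : EReal) < T := fun ht =>
    (EReal.coe_le_coe_iff.2 ht).trans_lt hbT
  have ha0 : 0 ≤ a := ht0.trans ha
  have hv0 : ∀ t ∈ Icc a b, 0 ≤ V t (x t) := fun t ht => hV0 t (x t) (ha0.trans ht.1)
  obtain ⟨C, hC⟩ := exists_le_of_regulated (v := fun t => V t (x t)) (a := a) (b := b)
    (fun s h => hs.continuousWithinAt_Ici_comp hγ hV ht0 (ha.trans h.1) (hT h.2))
    (fun s h => hs.exists_tendsto_left_comp hγ hV ht0 (ha.trans_lt h.1) (hT h.2))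
  have hfin : (γ ∩ Icc a b).Finite := (hγ.2 b).subset fun s h => ⟨h.1, h.2.2⟩
  have hvm : AEMeasurable (fun t => V t (x t)) (volume.restrict (Icc a b)) := by
    have hco : ContinuousOn (fun t => V t (x t)) (Icc a b \ (γ ∩ Icc a b)) := fun s h => by
      have hsγ : s ∉ γ := fun hm => h.2 ⟨hm, h.1⟩
      rcases h.1.1.eq_or_lt with rfl | hlt
      · exact (hs.continuousWithinAt_Ici_comp hγ hV ht0 ha (hT hab.le)).mono
          fun t ht => ht.1.1
      · exact (hs.continuousAt_comp hγ hV ht0 (ha.trans_lt hlt) (hT h.1.2)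
          hsγ).continuousWithinAt
    have hm := hco.aemeasurable (μ := volume) (measurableSet_Icc.diff hfin.measurableSet)
    rwa [Measure.restrict_congr_set (sdiff_null_ae_eq_self (hfin.measure_zero volume))] at hm
  have hD := hφ.integrableOn_comp hvm hv0 hC
  refine (le_of_guas_of_subsolution hφ hβ hG hab hv0 hC hvm (fun t1 t2 h1 h12 h2 => ?_) hw0).2
  refine le_add_integral_of_jumps (γ := γ) (v := fun t => V t (x t)) (hγ.2 b) hD ?_ ?_ h1 h12 h2
  · intro t1 t2 h1 h12 h2 hj
    refine le_add_integral_of_diniAlong_le h12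
      (hs.flow t1 t2 (ha.trans h1) h12 (hT h2) hj).1
      (hs.eq_add_integral (ha.trans h1) (hT h2) hj)
      (hV.locLipschitzOn_Icc hγ (ha0.trans h1) hj) (hD.mono_set (Icc_subset_Icc h1 h2)) ?_
    filter_upwards [hu] with s hus hst
    have hsab : s ∈ Ioc a b := ⟨h1.trans_lt hst.1, hst.2.le.trans h2⟩
    exact hflow s (x s) (u s) (ha0.trans hsab.1.le)
      (fun hm => eq_empty_iff_forall_notMem.1 hj s ⟨Ioo_subset_Ioc_self hst, hm⟩)
      ((hχ.mono (norm_nonneg _) (hus hsab)).trans (hge s hsab))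
  · intro τ hτ
    obtain ⟨L, hL, hxτ⟩ := hs.tendsto_left_comp hV hτ.1 (ha.trans_lt hτ.2.1) (hT hτ.2.2)
    refine ⟨_, hL, ?_⟩
    have hrL : χ r ≤ Vm τ L := ge_of_tendsto hL (eventually_of_mem (Ioo_mem_nhdsLT hτ.2.1)
      fun s h => hge s ⟨h.1, h.2.le.trans hτ.2.2⟩)
    rw [hxτ]
    exact hjump τ L (u τ) hτ.1 ((hχ.mono (norm_nonneg _) (huj τ hτ)).trans hrL)

theorem IsSolution.le_max_of_guas {n m : ℕ} {γ : Set ℝ} {f g : ℝ → Stt n → Stt m → Stt n}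
    {t0 : ℝ} {x0 : Stt n} {u : ℝ → Stt m} {T : EReal} {x : ℝ → Stt n} {V Vm : ℝ → Stt n → ℝ}
    {χ π : ℝ → ℝ} {φ β : ℝ → ℝ → ℝ}
    (hs : IsSolution γ f g t0 x0 u T x) (hγ : IsImpulseSeq γ) (hV : InClassV γ V Vm)
    (ht0 : 0 ≤ t0) (hχ : ClassKInf χ) (hπ : ClassKInf π) (hφ : Caratheodory2 φ) (hβ : ClassKL β)
    (hβ0 : ∀ w, 0 ≤ w → w ≤ β w 0) (hV0 : ∀ t ξ, 0 ≤ t → 0 ≤ V t ξ)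
    (hflow : ∀ t ξ μ, 0 ≤ t → t ∉ γ → χ ‖μ‖ ≤ V t ξ → DiniAlong f V t ξ μ ≤ -φ t (V t ξ))
    (hjump : ∀ t ξ μ, t ∈ γ → χ ‖μ‖ ≤ Vm t ξ → V t (ξ + g t ξ μ) ≤ Vm t ξ)
    (hjump' : ∀ t ξ μ, t ∈ γ → Vm t ξ ≤ χ ‖μ‖ → V t (ξ + g t ξ μ) ≤ π ‖μ‖)
    (hG : ∀ a T w, 0 ≤ a → IsMaxODESol (fun s r => -(φ s r)) a T w →
      T = ⊤ ∧ ∀ t, a ≤ t → w t ≤ β (w a) (t - a))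
    {t r : ℝ} (hr : 0 ≤ r) (ht : t0 ≤ t) (htT : (t : EReal) < T)
    (hu : ∀ᵐ s, s ∈ Ioc t0 t → ‖u s‖ ≤ r) (huj : ∀ τ ∈ γ ∩ Ioc t0 t, ‖u τ‖ ≤ r) :
    V t (x t) ≤ max (β (V t0 x0) (t - t0)) (β (χ r + π r) 0) := by
  by_cases hall : ∀ s ∈ Ioc t0 t, χ r ≤ V s (x s)
  · refine le_max_of_le_left ?_
    rcases ht.eq_or_lt with rfl | hlt
    · rw [sub_self, hs.init]
      exact hβ0 _ (hV0 _ _ ht0)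
    · exact hs.le_of_guas hγ hV ht0 hχ hφ hβ hV0 hflow hjump le_rfl hlt htT
        (fun T w => hG t0 T w ht0) hall hu huj (by rw [hs.init]) t ⟨ht, le_rfl⟩
  refine le_max_of_le_right ?_
  push Not at hall
  obtain ⟨s0, hs0, hvs0⟩ := hall
  set S : Set ℝ := {s ∈ Ioc t0 t | V s (x s) < χ r} with hS
  have hbdd : BddAbove S := ⟨t, fun s h => h.1.2⟩
  have hne : S.Nonempty := ⟨s0, hs0, hvs0⟩
  set σ := sSup S with hσ
  have h0σ : t0 < σ := hs0.1.trans_le (le_csSup hbdd ⟨hs0, hvs0⟩)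
  have hσt : σ ≤ t := csSup_le hne fun s h => h.1.2
  have hσT : (σ : EReal) < T := (EReal.coe_le_coe_iff.2 hσt).trans_lt htT
  have hχ0 := hχ.nonneg hr
  have hπ0 := hπ.nonneg hr
  have hvσ : V σ (x σ) ≤ χ r + π r := by
    by_cases hmem : σ ∈ S
    · linarith [hmem.2]
    have hfreq : ∃ᶠ s in nhdsWithin σ (Iio σ), V s (x s) ≤ χ r := by
      refine Filter.frequently_iff.2 fun {U} hU => ?_
      obtain ⟨l, hl, hlU⟩ := (mem_nhdsLT_iff_exists_Ioo_subset' h0σ).1 hU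
      obtain ⟨s, hsS, hls⟩ := exists_lt_of_lt_csSup hne hl
      have hsσ : s < σ := (le_csSup hbdd hsS).lt_of_ne fun h => hmem (by rwa [hσ, ← h])
      exact ⟨s, hlU ⟨hls, hsσ⟩, hsS.2.le⟩
    by_cases hσγ : σ ∈ γ
    · obtain ⟨L, hL, hxσ⟩ := hs.tendsto_left_comp hV hσγ h0σ hσT
      have hLr : Vm σ L ≤ χ r := le_of_tendsto_of_frequently hL hfreq
      rw [hxσ]
      rcases le_total (χ ‖u σ‖) (Vm σ L) with h | h
      · linarith [hjump σ L (u σ) hσγ h]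
      · linarith [hjump' σ L (u σ) hσγ h,
          hπ.mono (norm_nonneg _) (huj σ ⟨hσγ, h0σ, hσt⟩)]
    · have := (hs.continuousAt_comp hγ hV ht0 h0σ hσT hσγ).tendsto.mono_left
        (nhdsWithin_le_nhds (s := Iio σ))
      linarith [le_of_tendsto_of_frequently this hfreq]
  have hR : 0 ≤ χ r + π r := add_nonneg hχ0 hπ0
  rcases hσt.eq_or_lt with h | hlt
  · rw [← h]
    exact hvσ.trans (hβ0 _ hR)
  · have h1 := hs.le_of_guas hγ hV ht0 hχ hφ hβ hV0 hflow hjump h0σ.le hlt htT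
      (fun T w => hG σ T w (ht0.trans h0σ.le)) (r := r)
      (fun s h => le_of_not_gt fun hlt' =>
        absurd (le_csSup hbdd (show s ∈ S from ⟨⟨h0σ.trans h.1, h.2⟩, hlt'⟩)) (not_le.2 h.1))
      (hu.mono fun s h hm => h ⟨h0σ.trans hm.1, hm.2⟩)
      (fun τ h => huj τ ⟨h.1, h0σ.trans h.2.1, h.2.2⟩) hvσ t ⟨hσt, le_rfl⟩
    exact h1.trans ((hβ.2 _ hR).1 self_mem_Ici (sub_nonneg.2 hσt) (sub_nonneg.2 hσt))

theorem inputNorm_nonneg {m : ℕ} (γ : Set ℝ) (u : ℝ → Stt m) (I : Set ℝ) :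
    0 ≤ inputNorm γ u I :=
  le_max_of_le_right (Real.sSup_nonneg (by
    rintro _ ⟨t, -, rfl⟩
    exact norm_nonneg _))

theorem IsInput.ae_norm_le_inputNorm {m : ℕ} {u : ℝ → Stt m} (hu : IsInput u) (γ : Set ℝ)
    {t0 t : ℝ} (ht0 : 0 ≤ t0) :
    ∀ᵐ s, s ∈ Ioc t0 t → ‖u s‖ ≤ inputNorm γ u (Ioc t0 t) := by
  obtain ⟨C, hC⟩ := hu.2 t
  have hb : ∀ᵐ s ∂volume.restrict (Ioc t0 t), ‖u s‖ ≤ C :=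
    (ae_restrict_iff' measurableSet_Ioc).2
      (hC.mono fun s h hs => h ⟨ht0.trans hs.1.le, hs.2⟩)
  have := ae_le_essSup (μ := volume.restrict (Ioc t0 t)) (f := fun s => ‖u s‖)
    (isBoundedUnder_of_eventually_le hb)
  exact ((ae_restrict_iff' measurableSet_Ioc).1 this).mono
    fun s h hs => (h hs).trans (le_max_left _ _)

theorem norm_le_inputNorm {m : ℕ} {γ : Set ℝ} (hγ : IsImpulseSeq γ) (u : ℝ → Stt m)
    {t0 t τ : ℝ} (hτ : τ ∈ γ ∩ Ioc t0 t) : ‖u τ‖ ≤ inputNorm γ u (Ioc t0 t) := by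
  have hfin : (γ ∩ Ioc t0 t).Finite := (hγ.2 t).subset fun s h => ⟨h.1, h.2.2⟩
  exact le_max_of_le_right (le_csSup (hfin.image _).bddAbove (mem_image_of_mem _ hτ))

namespace ClassKInf

variable {α κ : ℝ → ℝ}

theorem comp (hα : ClassKInf α) (hκ : ClassKInf κ) : ClassKInf fun r => α (κ r) := by
  refine ⟨hα.1.comp hκ.1 fun r hr => hκ.nonneg hr,
    fun r hr s hs hrs => hα.2.1 (hκ.nonneg hr) (hκ.nonneg hs) (hκ.2.1 hr hs hrs), ?_, fun M => ?_⟩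
  · simp only [hκ.2.2.1, hα.2.2.1]
  · obtain ⟨r, hr, hM⟩ := hα.2.2.2 M
    obtain ⟨s, hs, hrs⟩ := hκ.2.2.2 r
    exact ⟨s, hs, hM.trans (hα.mono hr hrs)⟩

theorem add (hα : ClassKInf α) (hκ : ClassKInf κ) : ClassKInf fun r => α r + κ r := by
  refine ⟨hα.1.add hκ.1, fun r hr s hs hrs => add_lt_add (hα.2.1 hr hs hrs) (hκ.2.1 hr hs hrs),
    ?_, fun M => ?_⟩
  · simp only [hκ.2.2.1, hα.2.2.1, add_zero]
  · obtain ⟨r, hr, hM⟩ := hα.2.2.2 M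
    exact ⟨r, hr, hM.trans (le_add_of_nonneg_right (hκ.nonneg hr))⟩

theorem exists_leftInverse (hα : ClassKInf α) :
    ∃ ψ, ClassKInf ψ ∧ ∀ r, 0 ≤ r → ψ (α r) = r := by
  have hsurj : ∀ y : ℝ, 0 ≤ y → ∃ r, 0 ≤ r ∧ α r = y := fun y hy => by
    obtain ⟨R, hR, hyR⟩ := hα.2.2.2 y
    obtain ⟨r, hr, hry⟩ := intermediate_value_Icc hR (hα.1.mono Icc_subset_Ici_self)
      (show y ∈ Icc (α 0) (α R) from ⟨hα.2.2.1.trans_le hy, hyR⟩)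
    exact ⟨r, hr.1, hry⟩
  let a : Ici (0 : ℝ) → Ici (0 : ℝ) := fun r => ⟨α r, hα.nonneg r.2⟩
  have ha : StrictMono a := fun r s hrs => hα.2.1 r.2 s.2 hrs
  have ha' : Function.Surjective a := fun y => by
    obtain ⟨r, hr, hry⟩ := hsurj y y.2
    exact ⟨⟨r, hr⟩, Subtype.ext hry⟩
  let e := ha.orderIsoOfSurjective a ha'
  let ψ : ℝ → ℝ := fun y => e.symm (projIci 0 y)
  have hψ : ∀ r, 0 ≤ r → ψ (α r) = r := fun r hr => by
    have h1 : projIci 0 (α r) = e ⟨r, hr⟩ := projIci_of_mem (hα.nonneg hr)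
    simp only [ψ, h1, OrderIso.symm_apply_apply]
  refine ⟨ψ, ⟨(continuous_subtype_val.comp
    (e.symm.continuous.comp
      ((continuous_const.max continuous_id).subtype_mk _))).continuousOn, ?_, ?_, fun M => ?_⟩, hψ⟩
  · intro y hy z hz hyz
    simp only [ψ, projIci_of_mem hy, projIci_of_mem hz]
    exact e.symm.strictMono (show (⟨y, hy⟩ : Ici (0 : ℝ)) < ⟨z, hz⟩ from hyz)
  · have := hψ 0 le_rfl
    rwa [hα.2.2.1] at this
  · exact ⟨α (max M 0), hα.nonneg (le_max_right _ _),
      (le_max_left _ _).trans_eq (hψ _ (le_max_right _ _)).symm⟩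

theorem le_add_of_le_max (hα : ClassKInf α) {y a b : ℝ} (hy : 0 ≤ y) (ha : 0 ≤ a) (hb : 0 ≤ b)
    (h : y ≤ max a b) : α y ≤ α a + α b := by
  rcases le_max_iff.1 h with h | h
  · exact (hα.mono hy h).trans (le_add_of_nonneg_right (hα.nonneg hb))
  · exact (hα.mono hy h).trans (le_add_of_nonneg_left (hα.nonneg ha))

end ClassKInf

namespace ClassKL

variable {β : ℝ → ℝ → ℝ}

theorem comp {α κ : ℝ → ℝ} (hα : ClassKInf α) (hβ : ClassKL β) (hκ : ClassKInf κ) :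
    ClassKL fun r t => α (β (κ r) t) := by
  refine ⟨fun t ht => hα.comp ((hβ.1 t ht).comp hκ), fun r hr => ⟨?_, ?_⟩⟩
  · intro s hs t ht hst
    exact hα.mono ((hβ.1 t ht).nonneg (hκ.nonneg hr)) ((hβ.2 _ (hκ.nonneg hr)).1 hs ht hst)
  · have h0 : Tendsto α (nhdsWithin 0 (Ici 0)) (nhds 0) := by
      have := (hα.1 0 self_mem_Ici).tendsto
      rwa [hα.2.2.1] at this
    exact h0.comp (tendsto_nhdsWithin_iff.2 ⟨(hβ.2 _ (hκ.nonneg hr)).2,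
      (eventually_ge_atTop 0).mono fun t ht => (hβ.1 t ht).nonneg (hκ.nonneg hr)⟩)

theorem comp_time (hβ : ClassKL β) {κ : ℝ → ℝ} (hκ0 : ∀ s, 0 ≤ κ s)
    (hκm : MonotoneOn κ (Ici 0)) (hκt : Tendsto κ atTop atTop) :
    ClassKL fun r t => β r (κ t) :=
  ⟨fun t _ => hβ.1 _ (hκ0 t), fun r hr =>
    ⟨fun s hs t ht hst => (hβ.2 r hr).1 (hκ0 s) (hκ0 t) (hκm hs ht hst),
      (hβ.2 r hr).2.comp hκt⟩⟩

end ClassKL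

theorem Caratheodory2.le_of_guas {φ β : ℝ → ℝ → ℝ} (hφ : Caratheodory2 φ) (hβ : ClassKL β)
    (hφ0 : ∀ t, 0 ≤ t → φ t 0 = 0)
    (hG : ∀ T w, IsMaxODESol (fun s r => -(φ s r)) 0 T w →
      T = ⊤ ∧ ∀ t, 0 ≤ t → w t ≤ β (w 0) (t - 0)) {w : ℝ} (hw : 0 ≤ w) :
    w ≤ β w 0 := by
  refine (le_of_guas_of_subsolution (v := fun _ => 0) (C := 0) hφ hβ hG one_pos
    (fun _ _ => le_rfl) (fun _ _ => le_rfl) aemeasurable_const (fun t1 t2 h1 h12 _ => ?_) hw).1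
  rw [intervalIntegral.integral_congr (g := fun _ => (0 : ℝ)) fun s hs => ?_]
  · simp
  · rw [uIcc_of_le h12] at hs
    simp [hφ0 s (h1.trans hs.1)]

theorem exists_lower_inverse {ψ : ℝ → ℝ} (hψm : MonotoneOn ψ (Ici 0))
    (hψ : ∀ t, 0 ≤ t → t ≤ ψ t) :
    ∃ κ : ℝ → ℝ, (∀ s, 0 ≤ κ s) ∧ MonotoneOn κ (Ici 0) ∧ Tendsto κ atTop atTop ∧
      ∀ s t, 0 ≤ t → s ≤ ψ t → κ s ≤ t := by
  have hne : ∀ s, 0 ≤ s → {t | 0 ≤ t ∧ s ≤ ψ t}.Nonempty := fun s hs => ⟨s, hs, hψ s hs⟩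
  have hbdd : ∀ s, BddBelow {t | 0 ≤ t ∧ s ≤ ψ t} := fun s => ⟨0, fun t ht => ht.1⟩
  refine ⟨fun s => sInf {t | 0 ≤ t ∧ s ≤ ψ t}, fun s => Real.sInf_nonneg fun t ht => ht.1,
    fun s _ s' hs' hss => csInf_le_csInf (hbdd s) (hne s' hs') fun t ht => ⟨ht.1, hss.trans ht.2⟩,
    tendsto_atTop.2 fun M => ?_, fun s t ht hst => csInf_le (hbdd s) ⟨ht, hst⟩⟩
  filter_upwards [eventually_ge_atTop 0, eventually_gt_atTop (ψ (max M 0))] with s hs0 hs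
  refine le_csInf (hne s hs0) fun t ht => le_of_not_gt fun htM => ?_
  have := hψm ht.1 (le_max_right M 0) (htM.le.trans (le_max_left _ _))
  linarith [ht.2]

theorem WeaklyISS.stronglyISS {n m : ℕ} {Λ : Type*} {γ : Λ → Set ℝ}
    {f g : Λ → ℝ → Stt n → Stt m → Stt n} {h0 h : ℝ → Stt n → ℝ}
    (hw : WeaklyISS γ f g h0 h) (hh0 : ∀ t ξ, 0 ≤ t → 0 ≤ h0 t ξ) (hU : UIB (range γ)) :
    StronglyISS γ f g h0 h := by
  obtain ⟨β, ρ, hβ, hρ, hb⟩ := hw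
  obtain ⟨φ, -, hφm, hφ0, hφ⟩ := hU
  obtain ⟨κ, hκ0, hκm, hκt, hκ⟩ := exists_lower_inverse (ψ := fun t => t + φ t)
    (fun s hs t ht hst => add_le_add hst (hφm hs ht hst))
    fun t ht => le_add_of_nonneg_right (hφ0 t ht)
  refine ⟨_, ρ, hβ.comp_time hκ0 hκm hκt, hρ, fun l t0 x0 u T x ht0 hu hx t ht htT =>
    (hb l t0 x0 u T x ht0 hu hx t ht htT).trans (add_le_add_left ?_ _)⟩
  have hn : (nJumps (γ l) t0 t : ℝ) ≤ φ (t - t0) := by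
    rcases ht.eq_or_lt with rfl | hlt
    · simpa [nJumps] using hφ0 0 le_rfl
    · exact hφ _ (mem_range_self l) t0 t ht0 hlt
  have ht' : 0 ≤ t - t0 := sub_nonneg.2 ht
  exact (hβ.2 _ (hh0 t0 x0 ht0)).1 (hκ0 _) ht' (hκ _ _ ht' (add_le_add_right hn _))

/-- Theorem 2: Assumption 1 with `α_λ(t,r) = r` and GUAS continuous part implies
weak `(h⁰,h)`-ISS, and, under UIB, strong `(h⁰,h)`-ISS. -/
theorem stmt3 {n m : ℕ} {Λ : Type*} (γ : Λ → Set ℝ)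
    (f g : Λ → ℝ → Stt n → Stt m → Stt n)
    (hγ : ∀ l : Λ, IsImpulseSeq (γ l))
    (h0 h : ℝ → Stt n → ℝ)
    (hh0 : ∀ (t : ℝ) (ξ : Stt n), 0 ≤ t → 0 ≤ h0 t ξ)
    (hh : ∀ (t : ℝ) (ξ : Stt n), 0 ≤ t → 0 ≤ h t ξ)
    (V Vm : Λ → ℝ → Stt n → ℝ) (φ1 φ2 χ π : ℝ → ℝ)
    (vφ : Λ → ℝ → ℝ → ℝ)
    (hA1 : Assumption1 γ f g h0 h V Vm φ1 φ2 χ π vφ (fun _ _ r => r))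
    (hvφ0 : ∀ (l : Λ) (t : ℝ), 0 ≤ t → vφ l t 0 = 0)
    (hGUAS : ODEFamilyGUAS vφ) :
    WeaklyISS γ f g h0 h ∧ (UIB (Set.range γ) → StronglyISS γ f g h0 h) := by
  obtain ⟨hφ1, hφ2, hχ, hπ, hV, hφ, -, hVb, hflow, hjump, hjump'⟩ := hA1
  obtain ⟨β, hβ, hG⟩ := hGUAS
  suffices hw : WeaklyISS γ f g h0 h from ⟨hw, hw.stronglyISS hh0⟩
  obtain ⟨ψ, hψ, hψφ⟩ := hφ1.exists_leftInverse
  have hV0 : ∀ l t ξ, 0 ≤ t → 0 ≤ V l t ξ := fun l t ξ ht =>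
    (hφ1.nonneg (hh t ξ ht)).trans (hVb l t ξ ht).1
  refine ⟨fun r t => ψ (β (φ2 r) t), fun r => ψ (β (χ r + π r) 0), hβ.comp hψ hφ2,
    hψ.comp ((hβ.1 0 le_rfl).comp (hχ.add hπ)), fun l t0 x0 u T x ht0 hu hx t ht htT => ?_⟩
  have ht' : 0 ≤ t - t0 := sub_nonneg.2 ht
  have ht0' : 0 ≤ t := ht0.trans ht
  have hr := inputNorm_nonneg (γ l) u (Ioc t0 t)
  have hv := hx.1.le_max_of_guas (hγ l) (hV l) ht0 hχ hπ (hφ l) hβ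
    (fun w hw => (hφ l).le_of_guas hβ (hvφ0 l) (fun T w => hG l 0 T w le_rfl) hw) (hV0 l)
    (hflow l) (hjump l) (hjump' l) (hG l) hr ht htT (hu.ae_norm_le_inputNorm (γ l) ht0)
    (fun τ hτ => norm_le_inputNorm (hγ l) u hτ)
  have hφ20 := hφ2.nonneg (hh0 t0 x0 ht0)
  have h1 : β (V l t0 x0) (t - t0) ≤ β (φ2 (h0 t0 x0)) (t - t0) :=
    (hβ.1 _ ht').mono (hV0 l t0 x0 ht0) (hVb l t0 x0 ht0).2
  calc h t (x t) = ψ (φ1 (h t (x t))) := (hψφ _ (hh t _ ht0')).symm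
    _ ≤ ψ (V l t (x t)) := hψ.mono (hφ1.nonneg (hh t _ ht0')) (hVb l t _ ht0').1
    _ ≤ _ := hψ.le_add_of_le_max (hV0 l t _ ht0') ((hβ.1 _ ht').nonneg hφ20)
        ((hβ.1 0 le_rfl).nonneg (add_nonneg (hχ.nonneg hr) (hπ.nonneg hr)))
        (hv.trans (max_le_max_right _ h1))

end
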